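/- Let d ≥ 3 be an integer and let p > d/(d-2). Then the bilinear discrete spherical maximal operator T* is bounded from l^∞(ℤ^d) × l^p(ℤ^d) to l^p(ℤ^d): there exists a constant C = C(d,p) such that for all f ∈ l^∞(ℤ^d) and g ∈ l^p(ℤ^d), ‖T*(f,g)‖_{l^p(ℤ^d)} ≤ C ‖f‖_{l^∞(ℤ^d)} ‖g‖_{l^p(ℤ^d)}. -/

import Mathlib

open scoped ENNReal NNReal BigOperators

noncomputable section

/-- `ℤ^d` -/
abbrev V (d : ℕ) := Fin d → ℤ

/-- The sphere `{(u,v) ∈ ℤ^d × ℤ^d : |u|² + |v|² = λ}`. -/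
def sph (d lam : ℕ) : Set (V d × V d) :=
  {uv | (∑ i, uv.1 i ^ 2) + (∑ i, uv.2 i ^ 2) = (lam : ℤ)}

/-- `N(λ)`, the number of lattice points on the sphere of radius `λ^{1/2}` in `ℝ^{2d}`. -/
def Ncount (d lam : ℕ) : ℕ := Nat.card (sph d lam)

/-- The bilinear discrete spherical average `T_λ(f,g)(x)`. -/
def avg (d lam : ℕ) (f g : V d → ℂ) (x : V d) : ℂ :=
  (Ncount d lam : ℂ)⁻¹ *
    ∑' uv : sph d lam, f (x - (uv : V d × V d).1) * g (x - (uv : V d × V d).2)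

/-- The bilinear discrete spherical maximal function
`T*(f,g)(x) = sup_{λ ∈ ℕ, N(λ) > 0} |T_λ(f,g)(x)|`. -/
def maxOp (d : ℕ) (f g : V d → ℂ) (x : V d) : ℝ≥0∞ :=
  ⨆ (lam : ℕ) (_ : 0 < Ncount d lam), (‖avg d lam f g x‖₊ : ℝ≥0∞)

/-- The `l^p(ℤ^d)` norm of a complex-valued function. -/
def lpNorm (d : ℕ) (p : ℝ) (f : V d → ℂ) : ℝ≥0∞ :=
  (∑' x : V d, (‖f x‖₊ : ℝ≥0∞) ^ p) ^ (1 / p)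

/-- The `l^p(ℤ^d)` norm of an `ℝ≥0∞`-valued function. -/
def lpNormE (d : ℕ) (p : ℝ) (F : V d → ℝ≥0∞) : ℝ≥0∞ :=
  (∑' x : V d, F x ^ p) ^ (1 / p)

/-- The `l^∞(ℤ^d)` norm. -/
def linftyNorm (d : ℕ) (f : V d → ℂ) : ℝ≥0∞ :=
  ⨆ x : V d, (‖f x‖₊ : ℝ≥0∞)

namespace BilinearSpherical

open Finset

/-- Triples `(h, a, b)` with `a, b > 0` and `h² + 4ab = D`. -/
def riverForms (D : ℤ) : Finset (ℤ × ℤ × ℤ) :=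
  {t ∈ Icc (-D) D ×ˢ Icc 1 D ×ˢ Icc 1 D | t.1 ^ 2 + 4 * t.2.1 * t.2.2 = D}

lemma mem_riverForms {D h a b : ℤ} :
    (h, a, b) ∈ riverForms D ↔ 0 < a ∧ 0 < b ∧ h ^ 2 + 4 * a * b = D := by
  simp only [riverForms, mem_filter, mem_product, mem_Icc]
  constructor
  · rintro ⟨⟨_, ⟨_, _⟩, _, _⟩, h3⟩
    exact ⟨by omega, by omega, h3⟩
  · rintro ⟨ha, hb, h3⟩
    have hab : 0 < a * b := mul_pos ha hb
    refine ⟨⟨⟨?_, ?_⟩, ⟨by omega, ?_⟩, by omega, ?_⟩, h3⟩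
    · nlinarith [sq_nonneg (h + 1)]
    · nlinarith [sq_nonneg (h - 1)]
    · nlinarith [sq_nonneg h]
    · nlinarith [sq_nonneg h]

lemma sum_riverForms_odd (D : ℤ) :
    ∑ t ∈ riverForms D, t.1 * t.2.1 ^ 2 = 0 := by
  have : ∑ t ∈ riverForms D, t.1 * t.2.1 ^ 2 = ∑ t ∈ riverForms D, -(t.1 * t.2.1 ^ 2) := by
    refine sum_nbij' (fun t => (-t.1, t.2.1, t.2.2)) (fun t => (-t.1, t.2.1, t.2.2)) ?_ ?_ ?_ ?_ ?_
    all_goals rintro ⟨h, a, b⟩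
    all_goals simp [mem_riverForms]
  rw [sum_neg_distrib] at this
  linarith

lemma sum_riverForms_split (D : ℤ) (F : ℤ → ℤ → ℤ → ℤ) :
    ∑ t ∈ riverForms D, F t.1 t.2.1 t.2.2 =
      ∑ t ∈ riverForms D with t.2.2 = t.2.1 + t.1, F t.1 t.2.1 t.2.2 +
      ∑ t ∈ riverForms D with t.2.1 + t.1 < t.2.2,
        (F t.1 t.2.1 t.2.2 + F (-t.1) t.2.2 t.2.1) := by
  have key : ∑ t ∈ riverForms D with t.2.2 < t.2.1 + t.1, F t.1 t.2.1 t.2.2 =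
      ∑ t ∈ riverForms D with t.2.1 + t.1 < t.2.2, F (-t.1) t.2.2 t.2.1 := by
    refine sum_nbij' (fun t => (-t.1, t.2.2, t.2.1)) (fun t => (-t.1, t.2.2, t.2.1)) ?_ ?_ ?_ ?_ ?_
    all_goals rintro ⟨h, a, b⟩
    all_goals simp only [mem_filter, mem_riverForms, neg_neg, implies_true]
    · rintro ⟨⟨h1, h2, h3⟩, h4⟩
      exact ⟨⟨h2, h1, by linarith⟩, by linarith⟩
    · rintro ⟨⟨h1, h2, h3⟩, h4⟩
      exact ⟨⟨h2, h1, by linarith⟩, by linarith⟩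
  rw [sum_add_distrib, ← key,
    ← sum_filter_add_sum_filter_not (riverForms D) (fun t => t.2.2 = t.2.1 + t.1)]
  congr 1
  rw [← sum_filter_add_sum_filter_not
    ((riverForms D).filter fun t => ¬ t.2.2 = t.2.1 + t.1) (fun t => t.2.1 + t.1 < t.2.2),
    filter_filter, filter_filter]
  congr 1
  · refine sum_congr (filter_congr fun t _ => ?_) fun _ _ => rfl
    omega
  · refine sum_congr (filter_congr fun t _ => ?_) fun _ _ => rfl
    omega

lemma sum_riverForms_superbase (D : ℤ) :
    ∑ t ∈ riverForms D with t.2.1 + t.1 < t.2.2,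
      ((t.2.1 * t.2.2 - t.1 ^ 2) * (t.2.1 + t.2.2) - t.1 * (t.2.1 ^ 2 - t.2.2 ^ 2)) = 0 := by
  set E : ℤ × ℤ × ℤ → ℤ := fun t =>
    (t.2.1 * t.2.2 - t.1 ^ 2) * (t.2.1 + t.2.2) - t.1 * (t.2.1 ^ 2 - t.2.2 ^ 2) with hE
  have : ∑ t ∈ riverForms D with t.2.1 + t.1 < t.2.2, E t =
      ∑ t ∈ riverForms D with t.2.1 + t.1 < t.2.2, -E t := by
    refine sum_nbij' (fun t => (-t.1 - 2 * t.2.1, t.2.1, t.2.2 - t.1 - t.2.1))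
      (fun t => (-t.1 - 2 * t.2.1, t.2.1, t.2.2 - t.1 - t.2.1)) ?_ ?_ ?_ ?_ ?_
    all_goals rintro ⟨h, a, b⟩
    all_goals simp only [mem_filter, mem_riverForms, hE, Prod.mk.injEq]
    · rintro ⟨⟨h1, h2, h3⟩, h4⟩
      exact ⟨⟨h1, by linarith, by linear_combination h3⟩, by linarith⟩
    · rintro ⟨⟨h1, h2, h3⟩, h4⟩
      exact ⟨⟨h1, by linarith, by linear_combination h3⟩, by linarith⟩
    · intro _
      exact ⟨by ring, trivial, by ring⟩
    · intro _
      exact ⟨by ring, trivial, by ring⟩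
    · intro _
      ring
  rw [sum_neg_distrib] at this
  linarith

lemma sum_cubic_polynomial (s : ℕ) :
    12 * ∑ a ∈ range s, (a : ℤ) * (4 * a * s - 3 * a ^ 2 - (s : ℤ) ^ 2) =
      (s : ℤ) ^ 2 * ((s : ℤ) ^ 2 - 1) := by
  have h1 : ∀ n : ℕ, 2 * ∑ a ∈ range n, (a : ℤ) = n * (n - 1) := by
    intro n
    induction n with
    | zero => simp
    | succ n ih => rw [sum_range_succ, mul_add, ih]; push_cast; ring
  have h2 : ∀ n : ℕ, 6 * ∑ a ∈ range n, (a : ℤ) ^ 2 = n * (n - 1) * (2 * n - 1) := by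
    intro n
    induction n with
    | zero => simp
    | succ n ih => rw [sum_range_succ, mul_add, ih]; push_cast; ring
  have h3 : ∀ n : ℕ, 4 * ∑ a ∈ range n, (a : ℤ) ^ 3 = n ^ 2 * (n - 1) ^ 2 := by
    intro n
    induction n with
    | zero => simp
    | succ n ih => rw [sum_range_succ, mul_add, ih]; push_cast; ring
  have : ∑ a ∈ range s, (a : ℤ) * (4 * a * s - 3 * a ^ 2 - (s : ℤ) ^ 2) =
      4 * s * ∑ a ∈ range s, (a : ℤ) ^ 2 - 3 * ∑ a ∈ range s, (a : ℤ) ^ 3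
        - (s : ℤ) ^ 2 * ∑ a ∈ range s, (a : ℤ) := by
    rw [mul_sum, mul_sum, mul_sum, ← sum_sub_distrib, ← sum_sub_distrib]
    exact sum_congr rfl fun _ _ => by ring
  rw [this]
  linear_combination 8 * (s : ℤ) * h2 s - 9 * h3 s - 6 * (s : ℤ) ^ 2 * h1 s

open Classical in
/-- A Liouville-type identity, proved with the involutions of Conway's river. -/
lemma sum_riverForms (D : ℤ) (hD : 0 ≤ D) :
    12 * ∑ t ∈ riverForms D, (t.2.1 * t.2.2 - t.1 ^ 2) * t.2.1 =
      if IsSquare D then D * (D - 1) else 0 := by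
  have h1 := sum_riverForms_split D fun h a b => (a * b - h ^ 2) * a
  have h2 := sum_riverForms_split D fun h a _ => h * a ^ 2
  rw [sum_riverForms_odd] at h2
  have h3 := sum_riverForms_superbase D
  have h4 : ∑ t ∈ riverForms D, (t.2.1 * t.2.2 - t.1 ^ 2) * t.2.1 =
      ∑ t ∈ riverForms D with t.2.2 = t.2.1 + t.1,
        ((t.2.1 * t.2.2 - t.1 ^ 2) * t.2.1 - t.1 * t.2.1 ^ 2) := by
    rw [sum_sub_distrib, h1]
    rw [← sub_eq_zero]
    rw [← h3, ← sub_eq_zero, sum_sub_distrib]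
    have e1 : ∑ t ∈ riverForms D with t.2.1 + t.1 < t.2.2,
        ((t.2.1 * t.2.2 - t.1 ^ 2) * t.2.1 + (t.2.2 * t.2.1 - (-t.1) ^ 2) * t.2.2) =
        ∑ t ∈ riverForms D with t.2.1 + t.1 < t.2.2,
        ((t.2.1 * t.2.2 - t.1 ^ 2) * (t.2.1 + t.2.2)) := sum_congr rfl fun _ _ => by ring
    have e2 : ∑ t ∈ riverForms D with t.2.1 + t.1 < t.2.2,
        (t.1 * t.2.1 ^ 2 + -t.1 * t.2.2 ^ 2) =
        ∑ t ∈ riverForms D with t.2.1 + t.1 < t.2.2,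
        (t.1 * (t.2.1 ^ 2 - t.2.2 ^ 2)) := sum_congr rfl fun _ _ => by ring
    rw [e1, ← e2]
    linarith
  rw [h4]
  split_ifs with hs
  · obtain ⟨s, hs⟩ := hs
    obtain ⟨n, hn⟩ : ∃ n : ℕ, D = n ^ 2 := ⟨s.natAbs, by rw [Int.natAbs_sq, hs, sq]⟩
    subst hn
    rw [show ((n : ℤ) ^ 2 * (n ^ 2 - 1)) = _ from (sum_cubic_polynomial n).symm]
    congr 1
    rw [← sum_filter_of_ne (p := fun a : ℕ => 0 < a)]
    · refine sum_nbij' (fun t => t.2.1.toNat) (fun a => ((n : ℤ) - 2 * a, (a : ℤ), (n : ℤ) - a))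
        ?_ ?_ ?_ ?_ ?_
      · rintro ⟨h, a, b⟩
        simp only [mem_filter, mem_riverForms, mem_range]
        rintro ⟨⟨h1, h2, h3⟩, h4⟩
        have : (a + b) ^ 2 = (n : ℤ) ^ 2 := by rw [← h3, h4]; ring
        have := (sq_eq_sq₀ (by linarith) (by positivity)).1 this
        omega
      · intro a
        simp only [mem_filter, mem_riverForms, mem_range]
        rintro ⟨h1, h2⟩
        exact ⟨⟨by omega, by omega, by ring⟩, by ring⟩
      · rintro ⟨h, a, b⟩
        simp only [mem_filter, mem_riverForms, Prod.mk.injEq]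
        rintro ⟨⟨h1, h2, h3⟩, h4⟩
        have : (a + b) ^ 2 = (n : ℤ) ^ 2 := by rw [← h3, h4]; ring
        have := (sq_eq_sq₀ (by linarith) (by positivity)).1 this
        omega
      · intro a _
        simp
      · rintro ⟨h, a, b⟩
        simp only [mem_filter, mem_riverForms]
        rintro ⟨⟨h1, h2, h3⟩, h4⟩
        have : (a + b) ^ 2 = (n : ℤ) ^ 2 := by rw [← h3, h4]; ring
        have := (sq_eq_sq₀ (by linarith) (by positivity)).1 this
        rw [Int.toNat_of_nonneg h1.le, ← this, h4]
        ring
    · intro a _ h0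
      rcases Nat.eq_zero_or_pos a with rfl | h
      · simp at h0
      · exact h
  · rw [filter_eq_empty_iff.2, sum_empty, mul_zero]
    rintro ⟨h, a, b⟩ ht h0
    simp only [mem_riverForms] at ht h0
    refine hs ⟨a + b, ?_⟩
    rw [← ht.2.2, h0]
    ring

/-- Lattice points `x ∈ ℤ^k` with `|x|² = n`. -/
def latticeSphere (k : ℕ) (n : ℤ) : Finset (Fin k → ℤ) :=
  {x ∈ Fintype.piFinset fun _ => Icc (-n) n | ∑ i, x i ^ 2 = n}

/-- The number of representations of `n` as a sum of `k` squares. -/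
def repCount (k : ℕ) (n : ℤ) : ℕ := #(latticeSphere k n)

lemma abs_le_of_sq_le {a n : ℤ} (h : a ^ 2 ≤ n) : -n ≤ a ∧ a ≤ n :=
  ⟨by nlinarith [sq_nonneg (a + 1)], by nlinarith [sq_nonneg (a - 1)]⟩

lemma mem_latticeSphere {k : ℕ} {n : ℤ} {x : Fin k → ℤ} :
    x ∈ latticeSphere k n ↔ ∑ i, x i ^ 2 = n := by
  simp only [latticeSphere, mem_filter, Fintype.mem_piFinset, mem_Icc, and_iff_right_iff_imp]
  intro h i
  exact abs_le_of_sq_le (h ▸ single_le_sum (f := fun i => x i ^ 2)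
    (fun j _ => sq_nonneg (x j)) (mem_univ i))

lemma repCount_of_neg {k : ℕ} {n : ℤ} (hn : n < 0) : repCount k n = 0 := by
  rw [repCount, card_eq_zero, eq_empty_iff_forall_notMem]
  intro x hx
  rw [mem_latticeSphere] at hx
  have : 0 ≤ ∑ i, x i ^ 2 := sum_nonneg fun i _ => sq_nonneg (x i)
  omega

lemma repCount_at_zero (k : ℕ) : repCount k 0 = 1 := by
  rw [repCount, card_eq_one]
  refine ⟨0, ?_⟩
  ext x
  rw [mem_latticeSphere, mem_singleton, sum_eq_zero_iff_of_nonneg fun i _ => sq_nonneg (x i)]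
  simp [funext_iff]

lemma sum_latticeSphere_succ {k : ℕ} {n : ℤ} {s : Finset ℤ} (hs : ∀ a : ℤ, a ^ 2 ≤ n → a ∈ s)
    (φ : ℤ → ℤ) :
    ∑ x ∈ latticeSphere (k + 1) n, φ (x 0) = ∑ a ∈ s, φ a * repCount k (n - a ^ 2) := by
  have hm : ∀ x ∈ latticeSphere (k + 1) n, x 0 ∈ s := by
    intro x hx
    rw [mem_latticeSphere, Fin.sum_univ_succ] at hx
    exact hs _ (by linarith [sum_nonneg fun (i : Fin k) (_ : i ∈ univ) => sq_nonneg (x i.succ)])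
  rw [← sum_fiberwise_of_maps_to hm]
  refine sum_congr rfl fun a _ => ?_
  have : ∑ x ∈ latticeSphere (k + 1) n with x 0 = a, φ (x 0) =
      ∑ x ∈ latticeSphere (k + 1) n with x 0 = a, φ a :=
    sum_congr rfl fun x hx => by rw [(mem_filter.1 hx).2]
  rw [this, sum_const, nsmul_eq_mul, mul_comm]
  congr 2
  refine card_nbij' (fun x => Fin.tail x) (fun y => Fin.cons a y) ?_ ?_ ?_ ?_
  · intro x hx
    simp only [mem_coe, mem_filter, mem_latticeSphere, Fin.sum_univ_succ] at hx
    simp only [mem_coe, mem_latticeSphere, Fin.tail]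
    rw [← hx.1, hx.2]
    ring
  · intro y hy
    simp only [mem_coe, mem_latticeSphere] at hy
    simp [mem_latticeSphere, Fin.sum_univ_succ, hy]
  · intro x hx
    simp only [mem_coe, mem_filter] at hx
    rw [← hx.2]
    exact Fin.cons_self_tail x
  · intro y _
    simp

lemma repCount_succ {k : ℕ} {n : ℤ} {s : Finset ℤ} (hs : ∀ a : ℤ, a ^ 2 ≤ n → a ∈ s) :
    repCount (k + 1) n = ∑ a ∈ s, repCount k (n - a ^ 2) := by
  have := sum_latticeSphere_succ (k := k) hs fun _ => 1
  simp only [sum_const, nsmul_eq_mul, one_mul, mul_one] at this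
  exact_mod_cast this

lemma repCount_recurrence (k : ℕ) (n : ℤ) :
    ∑ a ∈ Icc (-n) n, (n - (k + 1) * a ^ 2) * repCount k (n - a ^ 2) = 0 := by
  rw [← sum_latticeSphere_succ (fun a ha => mem_Icc.2 (abs_le_of_sq_le ha))]
  have hsymm : ∀ i : Fin (k + 1), ∑ x ∈ latticeSphere (k + 1) n, x i ^ 2 =
      ∑ x ∈ latticeSphere (k + 1) n, x 0 ^ 2 := by
    intro i
    refine sum_nbij' (fun x => x ∘ Equiv.swap 0 i) (fun x => x ∘ Equiv.swap 0 i) ?_ ?_ ?_ ?_ ?_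
    · intro x hx
      rw [mem_latticeSphere] at hx ⊢
      rw [← hx]
      exact Equiv.sum_comp (Equiv.swap 0 i) fun j => x j ^ 2
    · intro x hx
      rw [mem_latticeSphere] at hx ⊢
      rw [← hx]
      exact Equiv.sum_comp (Equiv.swap 0 i) fun j => x j ^ 2
    · intro x _
      ext j
      simp
    · intro x _
      ext j
      simp
    · intro x _
      simp
  have h1 : ∑ x ∈ latticeSphere (k + 1) n, ∑ i, x i ^ 2 = ∑ x ∈ latticeSphere (k + 1) n, n :=
    sum_congr rfl fun x hx => mem_latticeSphere.1 hx
  rw [sum_comm, sum_congr rfl fun i _ => hsymm i, sum_const, card_univ, Fintype.card_fin,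
    nsmul_eq_mul] at h1
  rw [sum_sub_distrib, ← h1, ← mul_sum]
  push_cast
  ring

/-- The sum of `a` over factorizations `c * a * b = m` with `a, b > 0`. -/
def factorSum (c m : ℤ) : ℤ := ∑ p ∈ Icc 1 m ×ˢ Icc 1 m with c * p.1 * p.2 = m, p.1

lemma factorSum_nonpos {c m : ℤ} (hm : m ≤ 0) : factorSum c m = 0 := by
  rw [factorSum, Icc_eq_empty (by omega)]
  simp

/-- Jacobi's formula for the number of representations as a sum of four squares. -/
def jacobiFour (m : ℤ) : ℤ :=
  (if m = 0 then 1 else 0) + (8 * factorSum 1 m - 32 * factorSum 4 m)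

lemma sum_riverForms_four_mul (n : ℤ) :
    ∑ t ∈ riverForms (4 * n), (t.2.1 * t.2.2 - t.1 ^ 2) * t.2.1 =
      ∑ k ∈ Icc (-n) n, (n - 5 * k ^ 2) * factorSum 1 (n - k ^ 2) := by
  have hev : ∀ h a b : ℤ, h ^ 2 + 4 * a * b = 4 * n → ∃ k, h = 2 * k := by
    intro h a b hab
    have : Even (h ^ 2) := ⟨2 * n - 2 * a * b, by linarith⟩
    obtain ⟨k, hk⟩ := (Int.even_pow' two_ne_zero).1 this
    exact ⟨k, by omega⟩
  rw [← sum_fiberwise_of_maps_to (s := riverForms (4 * n)) (t := Icc (-n) n)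
    (g := fun t => t.1 / 2)]
  · refine sum_congr rfl fun k _ => ?_
    rw [factorSum, mul_sum]
    refine sum_nbij' (fun t => t.2) (fun p => (2 * k, p)) ?_ ?_ ?_ ?_ ?_
    · rintro ⟨h, a, b⟩ ht
      simp only [mem_filter, mem_riverForms] at ht
      obtain ⟨⟨h1, h2, h3⟩, h4⟩ := ht
      obtain ⟨k', rfl⟩ := hev h a b h3
      obtain rfl : k' = k := by omega
      have : a * b = n - k' ^ 2 := by linarith
      simp only [mem_filter, mem_product, mem_Icc]
      exact ⟨⟨⟨by omega, by nlinarith⟩, by omega, by nlinarith⟩, by linarith⟩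
    · rintro ⟨a, b⟩ hp
      simp only [mem_filter, mem_product, mem_Icc] at hp
      simp only [mem_filter, mem_riverForms]
      exact ⟨⟨by omega, by omega, by linarith [hp.2]⟩, by omega⟩
    · rintro ⟨h, a, b⟩ ht
      simp only [mem_filter, mem_riverForms] at ht
      obtain ⟨⟨h1, h2, h3⟩, h4⟩ := ht
      obtain ⟨k', rfl⟩ := hev h a b h3
      obtain rfl : k' = k := by omega
      rfl
    · intro p _
      rfl
    · rintro ⟨h, a, b⟩ ht
      simp only [mem_filter, mem_riverForms] at ht
      obtain ⟨⟨h1, h2, h3⟩, h4⟩ := ht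
      obtain ⟨k', rfl⟩ := hev h a b h3
      obtain rfl : k' = k := by omega
      dsimp only
      congr 1
      linarith
  · rintro ⟨h, a, b⟩ ht
    rw [mem_riverForms] at ht
    obtain ⟨h1, h2, h3⟩ := ht
    obtain ⟨k', rfl⟩ := hev h a b h3
    rw [mem_Icc, Int.mul_ediv_cancel_left _ two_ne_zero]
    exact abs_le_of_sq_le (by nlinarith [mul_pos h1 h2])

lemma sum_riverForms_eq_factorSum (n : ℤ) :
    16 * ∑ t ∈ riverForms n, (t.2.1 * t.2.2 - t.1 ^ 2) * t.2.1 =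
      ∑ k ∈ Icc (-n) n, (n - 5 * k ^ 2) * (4 * factorSum 4 (n - k ^ 2)) := by
  rw [← sum_fiberwise_of_maps_to (s := riverForms n) (t := Icc (-n) n) (g := fun t => t.1),
    mul_sum]
  · refine sum_congr rfl fun k _ => ?_
    rw [factorSum, mul_sum, mul_sum, mul_sum]
    refine sum_nbij' (fun t => t.2) (fun p => (k, p)) ?_ ?_ ?_ ?_ ?_
    · rintro ⟨h, a, b⟩ ht
      simp only [mem_filter, mem_riverForms] at ht
      obtain ⟨⟨h1, h2, h3⟩, rfl⟩ := ht
      have : 4 * (a * b) = n - h ^ 2 := by linarith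
      simp only [mem_filter, mem_product, mem_Icc]
      exact ⟨⟨⟨by omega, by nlinarith⟩, by omega, by nlinarith⟩, by linarith⟩
    · rintro ⟨a, b⟩ hp
      simp only [mem_filter, mem_product, mem_Icc] at hp
      simp only [mem_filter, mem_riverForms]
      exact ⟨⟨by omega, by omega, by linarith [hp.2]⟩, trivial⟩
    · rintro ⟨h, a, b⟩ ht
      rw [← (mem_filter.1 ht).2]
    · intro p _
      rfl
    · rintro ⟨h, a, b⟩ ht
      simp only [mem_filter, mem_riverForms] at ht
      obtain ⟨⟨h1, h2, h3⟩, rfl⟩ := ht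
      dsimp only
      linear_combination (4 * a) * h3
  · rintro ⟨h, a, b⟩ ht
    rw [mem_riverForms] at ht
    obtain ⟨h1, h2, h3⟩ := ht
    rw [mem_Icc]
    exact abs_le_of_sq_le (by nlinarith [mul_pos h1 h2])

lemma isSquare_four_mul_int {n : ℤ} : IsSquare (4 * n) ↔ IsSquare n := by
  constructor
  · rintro ⟨s, hs⟩
    have : Even (s * s) := ⟨2 * n, by linarith⟩
    obtain ⟨t, rfl⟩ : Even s := by simpa using Int.even_mul.1 this
    exact ⟨t, by linarith⟩
  · rintro ⟨s, rfl⟩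
    exact ⟨2 * s, by ring⟩

lemma sum_sq_eq_indicator {n : ℤ} (hn : 0 < n) [Decidable (IsSquare n)] :
    ∑ k ∈ Icc (-n) n, (n - 5 * k ^ 2) * (if n - k ^ 2 = 0 then 1 else 0) =
      if IsSquare n then -8 * n else 0 := by
  have e : ∀ k : ℤ, (n - 5 * k ^ 2) * (if n - k ^ 2 = 0 then 1 else 0) =
      if k ^ 2 = n then -4 * n else 0 := by
    intro k
    by_cases h : k ^ 2 = n
    · simp [h]; ring
    · rw [if_neg h, if_neg (by omega), mul_zero]
  simp only [e]
  rw [← sum_filter]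
  split_ifs with h
  · obtain ⟨s, rfl⟩ := h
    have hs : s ≠ 0 := by rintro rfl; simp at hn
    have : (Icc (-(s * s)) (s * s)).filter (fun k => k ^ 2 = s * s) = {s, -s} := by
      ext k
      simp only [mem_filter, mem_insert, mem_singleton, ← sq s, sq_eq_sq_iff_eq_or_eq_neg,
        and_iff_right_iff_imp, mem_Icc]
      intro h
      exact abs_le_of_sq_le (sq_eq_sq_iff_eq_or_eq_neg.2 h).le
    rw [this, sum_pair (by omega)]
    ring
  · rw [filter_eq_empty_iff.2, sum_empty]
    rintro k _ rfl
    exact h ⟨k, sq k⟩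

lemma jacobiFour_recurrence {n : ℤ} (hn : 0 < n) :
    ∑ k ∈ Icc (-n) n, (n - 5 * k ^ 2) * jacobiFour (n - k ^ 2) = 0 := by
  classical
  have h1 := sum_riverForms (4 * n) (by omega)
  have h2 := sum_riverForms n hn.le
  rw [sum_riverForms_four_mul] at h1
  have h3 := sum_riverForms_eq_factorSum n
  have h4 := sum_sq_eq_indicator hn
  simp only [isSquare_four_mul_int] at h1
  have : ∑ k ∈ Icc (-n) n, (n - 5 * k ^ 2) * jacobiFour (n - k ^ 2) =
      ∑ k ∈ Icc (-n) n, (n - 5 * k ^ 2) * (if n - k ^ 2 = 0 then 1 else 0) +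
      8 * ∑ k ∈ Icc (-n) n, (n - 5 * k ^ 2) * factorSum 1 (n - k ^ 2) -
      8 * ∑ k ∈ Icc (-n) n, (n - 5 * k ^ 2) * (4 * factorSum 4 (n - k ^ 2)) := by
    rw [mul_sum, mul_sum, ← sum_add_distrib, ← sum_sub_distrib]
    exact sum_congr rfl fun k _ => by rw [jacobiFour]; ring
  rw [this, ← h3]
  split_ifs at * <;> linarith

lemma recurrence_unique {u v : ℤ → ℤ} (hu : ∀ m < 0, u m = 0) (hv : ∀ m < 0, v m = 0)
    (h0 : u 0 = v 0)
    (hur : ∀ n > 0, ∑ k ∈ Icc (-n) n, (n - 5 * k ^ 2) * u (n - k ^ 2) = 0)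
    (hvr : ∀ n > 0, ∑ k ∈ Icc (-n) n, (n - 5 * k ^ 2) * v (n - k ^ 2) = 0) (n : ℕ) :
    u n = v n := by
  induction n using Nat.strong_induction_on with
  | _ n ih =>
    rcases Nat.eq_zero_or_pos n with rfl | hn
    · simpa using h0
    have hn' : (0 : ℤ) < n := by exact_mod_cast hn
    have h1 := hur n hn'
    have h2 := hvr n hn'
    have hm : (0 : ℤ) ∈ Icc (-(n : ℤ)) n := by simp
    rw [← add_sum_erase _ _ hm] at h1 h2
    have h3 : ∑ k ∈ (Icc (-(n : ℤ)) n).erase 0, (n - 5 * k ^ 2) * u (n - k ^ 2) =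
        ∑ k ∈ (Icc (-(n : ℤ)) n).erase 0, (n - 5 * k ^ 2) * v (n - k ^ 2) := by
      refine sum_congr rfl fun k hk => ?_
      congr 1
      have hk2 : 0 < k ^ 2 := by
        have := (mem_erase.1 hk).1
        positivity
      rcases lt_or_ge ((n : ℤ) - k ^ 2) 0 with h | h
      · rw [hu _ h, hv _ h]
      · obtain ⟨m, hm⟩ := Int.eq_ofNat_of_zero_le h
        rw [hm]
        exact ih m (by omega)
    rw [h3] at h1
    have h5 := h1.trans h2.symm
    simp only [ne_eq, OfNat.ofNat_ne_zero, not_false_eq_true, zero_pow, mul_zero, sub_zero,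
      add_left_inj] at h5
    exact mul_left_cancel₀ hn'.ne' h5

/-- Jacobi's four-square theorem. -/
lemma repCount_four (n : ℕ) : (repCount 4 n : ℤ) = jacobiFour n := by
  refine recurrence_unique (u := fun m => (repCount 4 m : ℤ)) (v := jacobiFour) ?_ ?_ ?_ ?_ ?_ n
  · intro m hm
    simp [repCount_of_neg hm]
  · intro m hm
    simp [jacobiFour, hm.ne, factorSum_nonpos hm.le]
  · simp [jacobiFour, repCount_at_zero, factorSum_nonpos le_rfl]
  · intro m _
    exact_mod_cast repCount_recurrence 4 m
  · intro m hm
    exact jacobiFour_recurrence hm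

lemma le_repCount_four {n : ℤ} (hn : 0 < n) (hodd : Odd n) : n ≤ repCount 4 n := by
  obtain ⟨m, rfl⟩ := Int.eq_ofNat_of_zero_le hn.le
  rw [repCount_four, jacobiFour, if_neg hn.ne']
  have h4 : factorSum 4 (m : ℤ) = 0 := by
    rw [factorSum, filter_eq_empty_iff.2, sum_empty]
    rintro ⟨a, b⟩ _ h
    obtain ⟨k, hk⟩ := hodd
    have : 2 * (2 * (a * b) - k) = 1 := by linarith
    omega
  have h1 : (m : ℤ) ≤ factorSum 1 m := by
    rw [factorSum]
    refine single_le_sum (f := fun p : ℤ × ℤ => p.1) (a := ((m : ℤ), (1 : ℤ))) ?_ ?_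
    · rintro ⟨a, b⟩ h
      simp only [mem_filter, mem_product, mem_Icc] at h
      dsimp only
      omega
    · simp only [mem_filter, mem_product, mem_Icc]
      omega
  omega

lemma sum_repCount_le_repCount_succ {k : ℕ} {n : ℤ} {ι : Type*} (s : Finset ι) (f : ι → ℤ)
    (hf : Function.Injective f) :
    ∑ t ∈ s, repCount k (n - f t ^ 2) ≤ repCount (k + 1) n := by
  rw [repCount_succ (s := s.map ⟨f, hf⟩ ∪ Icc (-n) n)
    fun a ha => mem_union_right _ (mem_Icc.2 (abs_le_of_sq_le ha))]
  have : ∑ t ∈ s, repCount k (n - f t ^ 2) =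
      ∑ a ∈ s.map ⟨f, hf⟩, repCount k (n - a ^ 2) := by
    rw [sum_map]
    rfl
  rw [this]
  exact sum_le_sum_of_subset subset_union_left

lemma exists_le_repCount_five :
    ∃ c : ℝ, 0 < c ∧ ∀ (N : ℕ) (n : ℤ), 1 ≤ N → (N : ℤ) ^ 2 ≤ n →
      c * N ^ 3 ≤ repCount 5 n := by
  refine ⟨1 / 16, by norm_num, fun N n hN hn => ?_⟩
  obtain ⟨ε, hε, hpar⟩ : ∃ ε : ℤ, (ε = 0 ∨ ε = 1 ∧ 2 ≤ n) ∧ ∀ t : ℤ, Odd (n - (2 * t + ε) ^ 2) := by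
    have hn1 : 1 ≤ n := by nlinarith
    rcases Int.even_or_odd n with h | h
    · refine ⟨1, Or.inr ⟨rfl, ?_⟩, fun t => ?_⟩
      · obtain ⟨m, rfl⟩ := h
        omega
      · exact h.sub_odd (Odd.pow ⟨t, rfl⟩)
    · refine ⟨0, Or.inl rfl, fun t => ?_⟩
      exact h.sub_even (Even.pow_of_ne_zero ⟨t, by ring⟩ two_ne_zero)
  have hlow : ∀ t ∈ range (N / 4 + 1), (N : ℤ) ^ 2 ≤ 4 * (n - (2 * (t : ℤ) + ε) ^ 2) := by
    intro t ht
    have ht4 : 4 * (t : ℤ) ≤ N := by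
      have := mem_range.1 ht
      omega
    have ht0 : (0 : ℤ) ≤ t := by positivity
    rcases hε with rfl | ⟨rfl, h2⟩
    · nlinarith
    · rcases le_or_gt 4 N with h | h
      · have : (4 : ℤ) ≤ N := by exact_mod_cast h
        nlinarith
      · have : (t : ℤ) = 0 := by omega
        rw [this]
        interval_cases N <;> norm_num at * <;> omega
  have hinj : Function.Injective fun t : ℕ => 2 * (t : ℤ) + ε := by
    intro a b hab
    dsimp only at hab
    omega
  have h1 := sum_repCount_le_repCount_succ (k := 4) (n := n) (range (N / 4 + 1)) _ hinj
  have h2 : ∀ t ∈ range (N / 4 + 1), (N : ℝ) ^ 2 / 4 ≤ repCount 4 (n - (2 * (t : ℤ) + ε) ^ 2) := by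
    intro t ht
    have h3 := hlow t ht
    have hpos : 0 < n - (2 * (t : ℤ) + ε) ^ 2 := by
      have : (1 : ℤ) ≤ (N : ℤ) ^ 2 := by exact_mod_cast Nat.one_le_pow _ _ hN
      omega
    have h4 := le_repCount_four hpos (hpar t)
    have h5 : (N : ℤ) ^ 2 ≤ 4 * (repCount 4 (n - (2 * (t : ℤ) + ε) ^ 2) : ℤ) := by omega
    have h6 : (N : ℝ) ^ 2 ≤ 4 * (repCount 4 (n - (2 * (t : ℤ) + ε) ^ 2) : ℝ) := by exact_mod_cast h5
    linarith
  have h3 := card_nsmul_le_sum _ _ _ h2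
  rw [card_range, nsmul_eq_mul] at h3
  have h4 : (N : ℝ) / 4 ≤ ((N / 4 + 1 : ℕ) : ℝ) := by
    have : N ≤ 4 * (N / 4 + 1) := by omega
    have : (N : ℝ) ≤ 4 * ((N / 4 + 1 : ℕ) : ℝ) := by exact_mod_cast this
    linarith
  calc 1 / 16 * (N : ℝ) ^ 3 = N / 4 * (N ^ 2 / 4) := by ring
    _ ≤ _ := mul_le_mul_of_nonneg_right h4 (by positivity)
    _ ≤ _ := h3
    _ ≤ _ := by exact_mod_cast h1

lemma exists_le_repCount (j : ℕ) :
    ∃ c : ℝ, 0 < c ∧ ∀ (N : ℕ) (n : ℤ), 1 ≤ N → (N : ℤ) ^ 2 ≤ n →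
      c * N ^ (j + 3) ≤ repCount (j + 5) n := by
  induction j with
  | zero => exact exists_le_repCount_five
  | succ j ih =>
    obtain ⟨c, hc, h⟩ := ih
    refine ⟨c / 2 ^ (j + 4), by positivity, fun N n hN hn => ?_⟩
    have h1 := sum_repCount_le_repCount_succ (k := j + 5) (n := n) (range (N / 2 + 1))
      (fun t : ℕ => (t : ℤ)) Nat.cast_injective
    have hhalf : (N : ℝ) / 2 ≤ ((N + 1) / 2 : ℕ) := by
      have : N ≤ 2 * ((N + 1) / 2) := by omega
      have : (N : ℝ) ≤ 2 * ((N + 1) / 2 : ℕ) := by exact_mod_cast this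
      linarith
    have h2 : ∀ t ∈ range (N / 2 + 1),
        c * ((N : ℝ) / 2) ^ (j + 3) ≤ repCount (j + 5) (n - (t : ℤ) ^ 2) := by
      intro t ht
      refine le_trans ?_ (h ((N + 1) / 2) _ (by omega) ?_)
      · gcongr
      · have ht2 : t ≤ N / 2 := by
          have := mem_range.1 ht
          omega
        rcases Nat.even_or_odd' N with ⟨m, rfl | rfl⟩
        · have e : (2 * m + 1) / 2 = m := by omega
          have : (t : ℤ) ≤ m := by omega
          rw [e]
          push_cast at hn
          nlinarith
        · have e : (2 * m + 1 + 1) / 2 = m + 1 := by omega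
          have : (t : ℤ) ≤ m := by omega
          rw [e]
          push_cast at hn ⊢
          nlinarith
    have h3 := card_nsmul_le_sum _ _ _ h2
    rw [card_range, nsmul_eq_mul] at h3
    have h4 : (N : ℝ) / 2 ≤ ((N / 2 + 1 : ℕ) : ℝ) := by
      have : N ≤ 2 * (N / 2 + 1) := by omega
      have : (N : ℝ) ≤ 2 * ((N / 2 + 1 : ℕ) : ℝ) := by exact_mod_cast this
      linarith
    calc c / 2 ^ (j + 4) * (N : ℝ) ^ (j + 1 + 3) = N / 2 * (c * (N / 2) ^ (j + 3)) := by
          rw [div_pow]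
          field_simp
          ring
      _ ≤ _ := mul_le_mul_of_nonneg_right h4 (by positivity)
      _ ≤ _ := h3
      _ ≤ _ := by exact_mod_cast h1

/-- The cube of radius `N` centred at `x` in `ℤ^d`. -/
def box {d : ℕ} (x : Fin d → ℤ) (N : ℕ) : Finset (Fin d → ℤ) :=
  Fintype.piFinset fun i => Icc (x i - N) (x i + N)

lemma mem_box {d : ℕ} {x y : Fin d → ℤ} {N : ℕ} :
    y ∈ box x N ↔ ∀ i, x i - N ≤ y i ∧ y i ≤ x i + N := by
  simp [box]

lemma self_mem_box {d : ℕ} (x : Fin d → ℤ) (N : ℕ) : x ∈ box x N :=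
  mem_box.2 fun i => ⟨by simp, by simp⟩

lemma card_box {d : ℕ} (x : Fin d → ℤ) (N : ℕ) : #(box x N) = (2 * N + 1) ^ d := by
  rw [box, Fintype.card_piFinset]
  have (i : Fin d) : #(Icc (x i - (N : ℤ)) (x i + N)) = 2 * N + 1 := by
    rw [Int.card_Icc]
    omega
  simp [this]

/-- The centred Hardy–Littlewood maximal function over cubes in `ℤ^d`. -/
def boxMax {d : ℕ} (g : (Fin d → ℤ) → ℝ≥0∞) (x : Fin d → ℤ) : ℝ≥0∞ :=
  ⨆ N : ℕ, (∑ y ∈ box x N, g y) / (2 * N + 1 : ℕ) ^ d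

lemma mul_card_le_of_lt_boxMax {d : ℕ} (g : (Fin d → ℤ) → ℝ≥0∞) (t : ℝ≥0∞)
    (E : Finset (Fin d → ℤ)) (hE : ∀ x ∈ E, t < boxMax g x) :
    t * #E ≤ 3 ^ d * ∑' y, g y := by
  have hN : ∀ x ∈ E, ∃ N : ℕ, t * (2 * N + 1 : ℕ) ^ d ≤ ∑ y ∈ box x N, g y := by
    intro x hx
    obtain ⟨N, h⟩ := lt_iSup_iff.1 (hE x hx)
    exact ⟨N, (ENNReal.le_div_iff_mul_le (Or.inl (by positivity))
      (Or.inl (ENNReal.pow_ne_top (ENNReal.natCast_ne_top _)))).1 h.le⟩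
  choose! n hn using hN
  obtain ⟨u, huE, hdisj, hcov⟩ := Vitali.exists_disjoint_subfamily_covering_enlargement
    (fun x => (box x (n x) : Set (Fin d → ℤ))) (E : Set (Fin d → ℤ)) (fun x => (n x : ℝ)) 2
    (by norm_num) (fun _ _ => by positivity) (E.sup n : ℕ)
    (fun a ha => by exact_mod_cast le_sup (f := n) ha)
    (fun a _ => ⟨a, self_mem_box a _⟩)
  lift u to Finset (Fin d → ℤ) using E.finite_toSet.subset huE
  have hsub : E ⊆ u.biUnion fun b => box b (3 * n b) := by
    intro a ha
    obtain ⟨b, hb, ⟨c, hca, hcb⟩, hle⟩ := hcov a ha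
    have hle' : n a ≤ 2 * n b := by exact_mod_cast hle
    refine mem_biUnion.2 ⟨b, hb, mem_box.2 fun i => ?_⟩
    have h1 := mem_box.1 hca i
    have h2 := mem_box.1 hcb i
    push_cast
    omega
  have hcard : #E ≤ ∑ b ∈ u, 3 ^ d * (2 * n b + 1) ^ d := by
    refine (card_le_card hsub).trans (card_biUnion_le.trans (sum_le_sum fun b _ => ?_))
    rw [card_box, ← mul_pow]
    exact Nat.pow_le_pow_left (by omega) d
  calc t * #E ≤ t * ∑ b ∈ u, 3 ^ d * ((2 * n b + 1 : ℕ) : ℝ≥0∞) ^ d := by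
        gcongr
        exact_mod_cast hcard
    _ = 3 ^ d * ∑ b ∈ u, t * ((2 * n b + 1 : ℕ) : ℝ≥0∞) ^ d := by
        simp only [mul_sum]
        exact sum_congr rfl fun _ _ => by ring
    _ ≤ 3 ^ d * ∑ b ∈ u, ∑ y ∈ box b (n b), g y := by
        gcongr with b hb
        exact hn b (huE hb)
    _ = 3 ^ d * ∑ y ∈ u.biUnion fun b => box b (n b), g y := by
        rw [sum_biUnion fun a ha b hb hab => ?_]
        exact disjoint_coe.1 (hdisj ha hb hab)
    _ ≤ _ := by
        gcongr
        exact ENNReal.sum_le_tsum _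

lemma boxMax_add_le {d : ℕ} (g h : (Fin d → ℤ) → ℝ≥0∞) (c : ℝ≥0∞) (hc : ∀ y, h y ≤ c)
    (x : Fin d → ℤ) : boxMax (fun y => g y + h y) x ≤ boxMax g x + c := by
  refine iSup_le fun N => ?_
  rw [sum_add_distrib, ENNReal.add_div]
  refine add_le_add (le_iSup (fun N : ℕ => (∑ y ∈ box x N, g y) / (2 * N + 1 : ℕ) ^ d) N) ?_
  refine ENNReal.div_le_of_le_mul ?_
  refine (sum_le_sum fun y _ => hc y).trans ?_
  rw [sum_const, card_box, nsmul_eq_mul, mul_comm]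
  push_cast
  rfl

/-- The weak-type estimate with the function truncated from below. -/
lemma mul_tsum_indicator_boxMax_le {d : ℕ} (g : (Fin d → ℤ) → ℝ≥0∞) (t : ℝ≥0∞) :
    t * ∑' x, (if 2 * t < boxMax g x then 1 else 0 : ℝ≥0∞) ≤
      3 ^ d * ∑' y, if t < g y then g y else 0 := by
  classical
  rw [ENNReal.tsum_eq_iSup_sum, ENNReal.mul_iSup]
  refine iSup_le fun E => ?_
  rw [← sum_filter, sum_const, nsmul_eq_mul, mul_one]
  refine mul_card_le_of_lt_boxMax _ t _ fun x hx => ?_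
  have hlt := (mem_filter.1 hx).2
  have hsplit : g = fun y => (if t < g y then g y else 0) + (if t < g y then 0 else g y) := by
    ext y
    split_ifs <;> simp
  have h := boxMax_add_le (fun y => if t < g y then g y else 0)
    (fun y => if t < g y then 0 else g y) t
    (fun y => by split_ifs with h <;> [exact zero_le; exact not_lt.1 h]) x
  rw [← hsplit] at h
  have h2 := hlt.trans_le h
  rw [two_mul] at h2
  by_contra hcon
  exact absurd h2 (not_lt.2 (add_le_add_left (not_lt.1 hcon) t))

lemma tsum_rpow_lt_le {s : ℝ} (hs : 0 < s) {a : ℝ≥0∞} (ha : a ≠ ∞) :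
    ∑' k : ℤ, (if (2 : ℝ≥0∞) ^ k < a then (2 : ℝ≥0∞) ^ (k * s) else 0) ≤
      (1 - 2 ^ (-s))⁻¹ * a ^ s := by
  rcases eq_or_ne a 0 with rfl | ha0
  · simp
  obtain ⟨K, hK1, hK2⟩ := ENNReal.exists_mem_Ioc_zpow ha0 ha (y := 2) (by norm_num) (by norm_num)
  have hinj : Function.Injective fun n : ℕ => K - (n : ℤ) := fun a b h => by
    simpa using h
  rw [← hinj.tsum_eq]
  · calc _ ≤ ∑' n : ℕ, (2 : ℝ≥0∞) ^ (K * s) * (2 ^ (-s)) ^ n := by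
          refine ENNReal.tsum_le_tsum fun n => ?_
          split_ifs
          · rw [← ENNReal.rpow_natCast, ← ENNReal.rpow_mul,
              ← ENNReal.rpow_add _ _ (by norm_num) (by norm_num)]
            push_cast
            exact (congrArg _ (by ring)).le
          · exact zero_le
      _ = (1 - 2 ^ (-s))⁻¹ * 2 ^ (K * s) := by
          rw [ENNReal.tsum_mul_left, ENNReal.tsum_geometric, mul_comm]
      _ ≤ _ := by
          rw [ENNReal.rpow_mul, ENNReal.rpow_intCast]
          gcongr
  · intro k hk
    have hk' : (2 : ℝ≥0∞) ^ k < a := by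
      by_contra h
      simp [h] at hk
    have hlt : k < K + 1 := by
      by_contra h
      exact absurd ((hk'.trans_le hK2).trans_le
        (ENNReal.zpow_le_of_le (by norm_num) (not_lt.1 h))) (lt_irrefl _)
    exact ⟨(K - k).toNat, by simp only; omega⟩

/-- The Hardy–Littlewood maximal function is bounded on `ℓ^r(ℤ^d)` for `r > 1`. -/
lemma exists_tsum_boxMax_rpow_le (d : ℕ) {r : ℝ} (hr : 1 < r) :
    ∃ C : ℝ≥0, ∀ g : (Fin d → ℤ) → ℝ≥0∞,
      ∑' x, boxMax g x ^ r ≤ C * ∑' x, g x ^ r := by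
  set s := r - 1 with hs
  have hs0 : 0 < s := by linarith
  set D : ℝ≥0∞ := 4 ^ r * 3 ^ d * (1 - 2 ^ (-s))⁻¹ with hD
  have hDtop : D ≠ ∞ := by
    refine ENNReal.mul_ne_top (ENNReal.mul_ne_top (by simp) (by simp)) ?_
    rw [ENNReal.inv_ne_top, ne_eq, tsub_eq_zero_iff_le, not_le]
    exact ENNReal.rpow_lt_one_of_one_lt_of_neg (by norm_num) (by linarith)
  have hD0 : D ≠ 0 := by
    refine mul_ne_zero (mul_ne_zero (by simp) (by simp)) ?_
    rw [ENNReal.inv_ne_zero]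
    exact ENNReal.sub_ne_top (by norm_num)
  refine ⟨D.toNNReal, fun g => ?_⟩
  rw [ENNReal.coe_toNNReal hDtop]
  by_cases htop : ∑' x, g x ^ r = ∞
  · rw [htop, ENNReal.mul_top hD0]
    exact le_top
  have hgle (y) : g y ≤ (∑' x, g x ^ r) ^ r⁻¹ := by
    rw [ENNReal.le_rpow_inv_iff (by linarith)]
    exact ENNReal.le_tsum y
  have hbound : (∑' x, g x ^ r) ^ r⁻¹ ≠ ∞ :=
    ENNReal.rpow_ne_top_of_nonneg (by positivity) htop
  have hgtop (y) : g y ≠ ∞ := ne_top_of_le_ne_top hbound (hgle y)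
  have hMtop (x) : boxMax g x ≠ ∞ := by
    refine ne_top_of_le_ne_top hbound ?_
    have := boxMax_add_le (fun _ => 0) g _ hgle x
    simpa [boxMax] using this
  have hpt (x) : boxMax g x ^ r ≤ ∑' k : ℤ, 4 ^ r * (2 : ℝ≥0∞) ^ (k * s) *
      ((2 : ℝ≥0∞) ^ k * if 2 * (2 : ℝ≥0∞) ^ k < boxMax g x then 1 else 0) := by
    rcases eq_or_ne (boxMax g x) 0 with h0 | h0
    · rw [h0, ENNReal.zero_rpow_of_pos (by linarith)]
      exact zero_le
    obtain ⟨K, hK1, hK2⟩ :=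
      ENNReal.exists_mem_Ioc_zpow h0 (hMtop x) (y := 2) (by norm_num) (by norm_num)
    have hzp : (2 : ℝ≥0∞) ^ K = 2 * 2 ^ (K - 1) := by
      rw [← ENNReal.rpow_intCast, ← ENNReal.rpow_intCast]
      nth_rw 2 [← ENNReal.rpow_one 2]
      rw [← ENNReal.rpow_add _ _ (by norm_num) (by norm_num)]
      push_cast
      ring_nf
    refine le_trans ?_ (ENNReal.le_tsum (K - 1))
    rw [if_pos (by rwa [← hzp]), mul_one, ← ENNReal.rpow_intCast, mul_assoc,
      ← ENNReal.rpow_add _ _ (by norm_num) (by norm_num)]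
    calc boxMax g x ^ r ≤ ((2 : ℝ≥0∞) ^ (K + 1)) ^ r := by gcongr
      _ = (2 : ℝ≥0∞) ^ (2 * r) * 2 ^ ((K - 1 : ℤ) * s + (K - 1 : ℤ)) := by
        rw [← ENNReal.rpow_intCast, ← ENNReal.rpow_mul,
          ← ENNReal.rpow_add _ _ (by norm_num) (by norm_num), hs]
        congr 1
        push_cast
        ring
      _ ≤ _ := by
        rw [ENNReal.rpow_mul]
        norm_num
  calc ∑' x, boxMax g x ^ r
      ≤ ∑' x, ∑' k : ℤ, 4 ^ r * (2 : ℝ≥0∞) ^ (k * s) *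
        ((2 : ℝ≥0∞) ^ k * if 2 * (2 : ℝ≥0∞) ^ k < boxMax g x then 1 else 0) :=
        ENNReal.tsum_le_tsum hpt
    _ = ∑' k : ℤ, 4 ^ r * (2 : ℝ≥0∞) ^ (k * s) * ((2 : ℝ≥0∞) ^ k *
        ∑' x, if 2 * (2 : ℝ≥0∞) ^ k < boxMax g x then 1 else 0) := by
        rw [ENNReal.tsum_comm]
        simp only [ENNReal.tsum_mul_left]
    _ ≤ ∑' k : ℤ, 4 ^ r * (2 : ℝ≥0∞) ^ (k * s) *
        (3 ^ d * ∑' y, if (2 : ℝ≥0∞) ^ k < g y then g y else 0) := by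
        refine ENNReal.tsum_le_tsum fun k => ?_
        exact mul_le_mul_right (mul_tsum_indicator_boxMax_le g _) _
    _ = 4 ^ r * 3 ^ d * ∑' y, g y * ∑' k : ℤ,
        if (2 : ℝ≥0∞) ^ k < g y then (2 : ℝ≥0∞) ^ (k * s) else 0 := by
        simp only [← ENNReal.tsum_mul_left]
        rw [ENNReal.tsum_comm]
        refine tsum_congr fun y => tsum_congr fun k => ?_
        split_ifs <;> ring
    _ ≤ 4 ^ r * 3 ^ d * ∑' y, g y * ((1 - 2 ^ (-s))⁻¹ * g y ^ s) := by
        gcongr with y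
        exact tsum_rpow_lt_le hs0 (hgtop y)
    _ = D * ∑' x, g x ^ r := by
        rw [hD, mul_assoc (4 ^ r * 3 ^ d), ← ENNReal.tsum_mul_left (a := (1 - 2 ^ (-s))⁻¹)]
        refine congrArg _ ?_
        refine tsum_congr fun y => ?_
        rw [show r = 1 + s by rw [hs]; ring, ENNReal.rpow_add_of_nonneg _ _ (by norm_num) hs0.le,
          ENNReal.rpow_one]
        ring

section Fejer

variable {M : ℕ}

/-- The indicator of `{0, …, 2N-1}` in `ℤ/M`. -/
def block (N M : ℕ) (x : ZMod M) : ℝ := ∑ j ∈ range (2 * N), if x = j then 1 else 0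

/-- The tent function `max(0, 2N - |x|)` on `ℤ/M`. -/
def tent (N M : ℕ) (x : ZMod M) : ℝ := ∑ i ∈ range (2 * N), block N M (x + i)

lemma block_nonneg (N : ℕ) (x : ZMod M) : 0 ≤ block N M x :=
  sum_nonneg fun _ _ => by split_ifs <;> norm_num

lemma tent_nonneg (N : ℕ) (x : ZMod M) : 0 ≤ tent N M x :=
  sum_nonneg fun _ _ => block_nonneg _ _

lemma block_succ_sub (N : ℕ) (x : ZMod M) :
    block N M (x + 1) - block N M x =
      (if x + 1 = 0 then 1 else 0) - if x + 1 = (2 * N : ℕ) then 1 else 0 := by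
  have h := sum_range_sub' (fun j : ℕ => if x + 1 = (j : ZMod M) then (1 : ℝ) else 0) (2 * N)
  simp only [Nat.cast_zero] at h
  rw [← h, sum_sub_distrib]
  simp [block]

lemma tent_succ_sub (N : ℕ) (x : ZMod M) :
    tent N M (x + 1) - tent N M x = block N M (x + (2 * N : ℕ)) - block N M x := by
  have h := sum_range_sub (fun i : ℕ => block N M (x + i)) (2 * N)
  simp only [Nat.cast_zero, add_zero] at h
  rw [← h, sum_sub_distrib, tent, tent]
  congr 1
  refine sum_congr rfl fun i _ => ?_
  push_cast
  rw [add_right_comm, add_assoc]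

lemma block_le_one {N : ℕ} (h : 2 * N ≤ M) (x : ZMod M) : block N M x ≤ 1 := by
  rw [block, ← sum_filter, sum_const, nsmul_eq_mul, mul_one]
  norm_cast
  refine card_le_one.2 fun a ha b hb => ?_
  rw [mem_filter, mem_range] at ha hb
  have := ha.2.symm.trans hb.2
  rw [ZMod.natCast_eq_natCast_iff', Nat.mod_eq_of_lt (by omega), Nat.mod_eq_of_lt (by omega)]
    at this
  exact this

lemma tent_le {N : ℕ} (h : 2 * N ≤ M) (x : ZMod M) : tent N M x ≤ 2 * N := by
  refine (sum_le_sum fun i _ => block_le_one h _).trans ?_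
  simp

lemma exists_intCast_of_tent_ne_zero {N : ℕ} {x : ZMod M} (hx : tent N M x ≠ 0) :
    ∃ m : ℤ, |m| ≤ 2 * N ∧ x = m := by
  obtain ⟨i, hi, hx⟩ := exists_ne_zero_of_sum_ne_zero hx
  obtain ⟨j, hj, hx⟩ := exists_ne_zero_of_sum_ne_zero hx
  have hx' : x + i = j := by
    by_contra h
    simp [h] at hx
  rw [mem_range] at hi hj
  refine ⟨j - i, by rw [abs_le]; omega, ?_⟩
  push_cast
  rw [← hx']
  ring

lemma le_tent {N : ℕ} {m : ℤ} (hm : |m| ≤ N) : (N : ℝ) ≤ tent N M m := by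
  have hone (i : ℕ) (h0 : 0 ≤ m + i) (h1 : m + i < 2 * N) : 1 ≤ block N M (m + i) := by
    have hmem : (m + i).toNat ∈ range (2 * N) := mem_range.2 (by omega)
    refine le_trans ?_ (single_le_sum (fun j _ => by split_ifs <;> norm_num) hmem)
    have : ((m : ZMod M) + i) = (((m + i).toNat : ℕ) : ZMod M) := by
      rw [← Int.cast_natCast (R := ZMod M) (m + i).toNat, Int.toNat_of_nonneg h0]
      push_cast
      rfl
    rw [if_pos this]
  rw [abs_le] at hm
  have hsub (s : Finset ℕ) (hs : s ⊆ range (2 * N)) (hc : #s = N)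
      (h : ∀ i ∈ s, 0 ≤ m + i ∧ m + i < 2 * N) : (N : ℝ) ≤ tent N M m := by
    calc (N : ℝ) = ∑ i ∈ s, 1 := by simp [hc]
      _ ≤ ∑ i ∈ s, block N M (m + i) := sum_le_sum fun i hi => hone i (h i hi).1 (h i hi).2
      _ ≤ _ := sum_le_sum_of_subset_of_nonneg hs fun _ _ _ => block_nonneg _ _
  rcases le_total 0 m with h0 | h0
  · refine hsub (range N) (range_subset_range.2 (by omega)) (by simp) fun i hi => ?_
    rw [mem_range] at hi
    omega
  · refine hsub (Ico N (2 * N)) (fun i hi => ?_) (by simp; omega) fun i hi => ?_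
    · rw [mem_Ico] at hi
      exact mem_range.2 hi.2
    · rw [mem_Ico] at hi
      omega

lemma abs_tent_succ_sub_le {N : ℕ} (h : 2 * N ≤ M) (x : ZMod M) :
    |tent N M (x + 1) - tent N M x| ≤ 1 := by
  rw [tent_succ_sub, abs_le]
  constructor <;>
    linarith [block_nonneg N x, block_nonneg N (x + ((2 * N : ℕ) : ZMod M)), block_le_one h x,
      block_le_one h (x + ((2 * N : ℕ) : ZMod M))]

variable [NeZero M]

lemma sum_comp_add_right (c : ZMod M) (f : ZMod M → ℝ) : ∑ x, f (x + c) = ∑ x, f x :=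
  Fintype.sum_equiv (Equiv.addRight c) _ _ fun _ => rfl

lemma sum_block (N : ℕ) : ∑ x : ZMod M, block N M x = 2 * N := by
  simp only [block]
  rw [sum_comm]
  simp

lemma sum_block_add (N : ℕ) (c : ZMod M) : ∑ x : ZMod M, block N M (x + c) = 2 * N := by
  rw [sum_comp_add_right c (block N M), sum_block]

lemma sum_tent (N : ℕ) : ∑ x : ZMod M, tent N M x = 4 * (N : ℝ) ^ 2 := by
  simp only [tent]
  rw [sum_comm]
  simp only [sum_block_add, sum_const, card_range, nsmul_eq_mul]
  push_cast
  ring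

lemma sum_abs_tent_succ_sub_le (N : ℕ) :
    ∑ x : ZMod M, |tent N M (x + 1) - tent N M x| ≤ 4 * N := by
  calc _ ≤ ∑ x : ZMod M, (block N M (x + (2 * N : ℕ)) + block N M x) := by
        refine sum_le_sum fun x _ => ?_
        rw [tent_succ_sub, abs_le]
        constructor <;> linarith [block_nonneg N x, block_nonneg N (x + ((2 * N : ℕ) : ZMod M))]
    _ = 4 * N := by
        rw [sum_add_distrib, sum_block_add, sum_block]
        ring

lemma sum_abs_block_succ_sub_le (N : ℕ) (c : ZMod M) :
    ∑ x : ZMod M, |block N M (x + c + 1) - block N M (x + c)| ≤ 2 := by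
  rw [sum_comp_add_right c (fun x => |block N M (x + 1) - block N M x|)]
  calc _ ≤ ∑ x : ZMod M, ((if x + 1 = 0 then (1 : ℝ) else 0) +
        if x + 1 = (2 * N : ℕ) then 1 else 0) := by
        refine sum_le_sum fun x _ => ?_
        rw [block_succ_sub]
        split_ifs <;> norm_num
    _ = 2 := by
        rw [sum_comp_add_right 1 (fun x => (if x = 0 then (1 : ℝ) else 0) +
          if x = ((2 * N : ℕ) : ZMod M) then 1 else 0), sum_add_distrib]
        norm_num

lemma sum_abs_tent_second_diff_le (N : ℕ) (c : ZMod M) :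
    ∑ x : ZMod M, |tent N M (x + c + 1) - 2 * tent N M (x + c) + tent N M (x + c - 1)| ≤ 4 := by
  rw [sum_comp_add_right c
      (fun x => |tent N M (x + 1) - 2 * tent N M x + tent N M (x - 1)|),
    ← sum_comp_add_right 1]
  calc _ ≤ ∑ x : ZMod M, (|block N M (x + (2 * N : ℕ) + 1) - block N M (x + (2 * N : ℕ))| +
        |block N M (x + 0 + 1) - block N M (x + 0)|) := by
        refine sum_le_sum fun x _ => (le_of_eq ?_).trans (abs_sub _ _)
        have h1 := tent_succ_sub N x
        have h2 := tent_succ_sub N (x + 1)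
        rw [add_right_comm x 1 ((2 * N : ℕ) : ZMod M)] at h2
        simp only [add_sub_cancel_right, add_zero]
        congr 1
        linarith
    _ ≤ 4 := by
        rw [sum_add_distrib]
        linarith [sum_abs_block_succ_sub_le (M := M) N (2 * N : ℕ),
          sum_abs_block_succ_sub_le (M := M) N 0]

/-- Summation by parts twice on `ℤ/M`. -/
lemma norm_sub_one_sq_mul_norm_sum_le (ψ : AddChar (ZMod M) ℂ) (hψ : ∀ x, ‖ψ x‖ = 1)
    (c : ZMod M → ℝ) (b : ZMod M) :
    ‖ψ b - 1‖ ^ 2 * ‖∑ x, (c x : ℂ) * ψ (b * x)‖ ≤ ∑ x, |c (x + 1) - 2 * c x + c (x - 1)| := by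
  have h1 : ∑ x, (c (x + 1) : ℂ) * ψ (b * x) = ψ (-b) * ∑ x, (c x : ℂ) * ψ (b * x) := by
    rw [mul_sum]
    refine Fintype.sum_equiv (Equiv.addRight 1) _ _ fun x => ?_
    simp only [Equiv.coe_addRight]
    rw [mul_left_comm, ← AddChar.map_add_eq_mul]
    ring_nf
  have h2 : ∑ x, (c (x - 1) : ℂ) * ψ (b * x) = ψ b * ∑ x, (c x : ℂ) * ψ (b * x) := by
    rw [mul_sum]
    refine Fintype.sum_equiv (Equiv.subRight 1) _ _ fun x => ?_
    simp only [Equiv.subRight_apply]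
    rw [mul_left_comm, ← AddChar.map_add_eq_mul]
    ring_nf
  have hinv : ψ (-b) * ψ b = 1 := by
    rw [← AddChar.map_add_eq_mul]
    simp
  have key : ∑ x, ((c (x + 1) - 2 * c x + c (x - 1) : ℝ) : ℂ) * ψ (b * x) =
      ψ (-b) * (ψ b - 1) ^ 2 * ∑ x, (c x : ℂ) * ψ (b * x) := by
    push_cast
    simp only [add_mul, sub_mul, sum_add_distrib, sum_sub_distrib, h1, h2, mul_assoc,
      ← mul_sum]
    linear_combination (-(ψ b) + 2) * (∑ x, (c x : ℂ) * ψ (b * x)) * hinv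
  have := congrArg (‖·‖) key
  simp only [norm_mul, hψ, one_mul, norm_pow] at this
  rw [← this]
  refine (norm_sum_le _ _).trans (sum_le_sum fun x _ => ?_)
  rw [norm_mul, hψ, mul_one, Complex.norm_real, Real.norm_eq_abs]

lemma norm_sum_tent_mul_tent_le {N : ℕ} (h : 2 * N ≤ M) (ψ : AddChar (ZMod M) ℂ)
    (hψ : ∀ x, ‖ψ x‖ = 1) (k b : ZMod M) :
    ‖∑ x, ((tent N M x * tent N M (x + k) : ℝ) : ℂ) * ψ (b * x)‖ ≤ 8 * N ^ 3 := by
  calc _ ≤ ∑ x, tent N M x * (2 * N) := by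
        refine (norm_sum_le _ _).trans (sum_le_sum fun x _ => ?_)
        rw [norm_mul, hψ, mul_one, Complex.norm_real, Real.norm_eq_abs,
          abs_of_nonneg (mul_nonneg (tent_nonneg _ _) (tent_nonneg _ _))]
        exact mul_le_mul_of_nonneg_left (tent_le h _) (tent_nonneg _ _)
    _ = _ := by
        rw [← sum_mul, sum_tent]
        ring

lemma norm_sub_one_sq_mul_norm_sum_tent_le {N : ℕ} (h : 2 * N ≤ M) (ψ : AddChar (ZMod M) ℂ)
    (hψ : ∀ x, ‖ψ x‖ = 1) (k b : ZMod M) :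
    ‖ψ b - 1‖ ^ 2 * ‖∑ x, ((tent N M x * tent N M (x + k) : ℝ) : ℂ) * ψ (b * x)‖ ≤ 24 * N := by
  refine (norm_sub_one_sq_mul_norm_sum_le ψ hψ _ b).trans ?_
  set w := tent N M
  have hw0 (x) : |w x| ≤ 2 * N := by
    rw [abs_of_nonneg (tent_nonneg _ _)]
    exact tent_le h x
  have hd (x) : |w (x + 1) - w x| ≤ 1 := abs_tent_succ_sub_le h x
  have hpt (x : ZMod M) : |w (x + 1) * w (x + 1 + k) - 2 * (w x * w (x + k)) +
      w (x - 1) * w (x - 1 + k)| ≤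
      2 * N * |w (x + 0 + 1) - 2 * w (x + 0) + w (x + 0 - 1)| +
      2 * N * |w (x + k + 1) - 2 * w (x + k) + w (x + k - 1)| +
      |w (x + 1) - w x| + |w (x - 1 + 1) - w (x - 1)| := by
    have e : w (x + 1) * w (x + 1 + k) - 2 * (w x * w (x + k)) + w (x - 1) * w (x - 1 + k) =
        (w (x + 0 + 1) - 2 * w (x + 0) + w (x + 0 - 1)) * w (x + k) +
        w x * (w (x + k + 1) - 2 * w (x + k) + w (x + k - 1)) +
        (w (x + 1) - w x) * (w (x + k + 1) - w (x + k)) +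
        (w (x - 1 + 1) - w (x - 1)) * (w (x + k - 1 + 1) - w (x + k - 1)) := by
      rw [add_right_comm x 1 k, show x - 1 + k = x + k - 1 by ring]
      simp only [add_zero, sub_add_cancel]
      ring
    rw [e]
    refine (abs_add_le _ _).trans (add_le_add ((abs_add_le _ _).trans (add_le_add
      ((abs_add_le _ _).trans (add_le_add ?_ ?_)) ?_)) ?_) <;> rw [abs_mul]
    · rw [mul_comm]
      exact mul_le_mul_of_nonneg_right (hw0 _) (abs_nonneg _)
    · exact mul_le_mul_of_nonneg_right (hw0 _) (abs_nonneg _)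
    · exact mul_le_of_le_one_right (abs_nonneg _) (hd _)
    · exact mul_le_of_le_one_right (abs_nonneg _) (hd _)
  refine (sum_le_sum fun x _ => hpt x).trans ?_
  rw [sum_add_distrib, sum_add_distrib, sum_add_distrib, ← mul_sum, ← mul_sum,
    ← sum_comp_add_right 1 (fun x => |w (x - 1 + 1) - w (x - 1)|)]
  simp only [add_sub_cancel_right]
  have hN : (0 : ℝ) ≤ N := by positivity
  have h1 := sum_abs_tent_second_diff_le (M := M) N 0
  have h2 := sum_abs_tent_second_diff_le (M := M) N k
  have h3 := sum_abs_tent_succ_sub_le (M := M) N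
  nlinarith [mul_le_mul_of_nonneg_left h1 hN, mul_le_mul_of_nonneg_left h2 hN]

/-- The weighted quadratic exponential sum modulo `M`. -/
def weylSum (N : ℕ) (ψ : AddChar (ZMod M) ℂ) (a : ZMod M) : ℂ :=
  ∑ x, (tent N M x : ℂ) * ψ (a * x ^ 2)

lemma norm_weylSum_sq_le (N : ℕ) (ψ : AddChar (ZMod M) ℂ) (hψ : ∀ x, ‖ψ x‖ = 1) (a : ZMod M) :
    ‖weylSum N ψ a‖ ^ 2 ≤ ∑ k ∈ Icc (-(4 * N : ℤ)) (4 * N),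
      ‖∑ x, ((tent N M x * tent N M (x + k) : ℝ) : ℂ) * ψ (a * (2 * k) * x)‖ := by
  classical
  have hconj (x : ZMod M) : (starRingEnd ℂ) (ψ x) = ψ (-x) := by
    rw [AddChar.map_neg_eq_inv, Complex.inv_def, Complex.normSq_eq_norm_sq, hψ]
    simp
  have hexp : weylSum N ψ a * (starRingEnd ℂ) (weylSum N ψ a) =
      ∑ k : ZMod M, ψ (a * k ^ 2) *
        ∑ x, ((tent N M x * tent N M (x + k) : ℝ) : ℂ) * ψ (a * (2 * k) * x) := by
    rw [weylSum, map_sum, sum_mul_sum, sum_comm]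
    simp only [mul_sum]
    rw [sum_comm (s := univ) (t := univ) (f := fun k x => ψ (a * k ^ 2) *
      (((tent N M x * tent N M (x + k) : ℝ) : ℂ) * ψ (a * (2 * k) * x)))]
    refine sum_congr rfl fun x _ => ?_
    refine (Fintype.sum_equiv (Equiv.addLeft x) _ _ fun k => ?_).symm
    simp only [Equiv.coe_addLeft, map_mul, hconj, Complex.conj_ofReal]
    have : ψ (a * (x + k) ^ 2) * ψ (-(a * x ^ 2)) = ψ (a * k ^ 2) * ψ (a * (2 * k) * x) := by
      rw [← AddChar.map_add_eq_mul, ← AddChar.map_add_eq_mul]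
      ring_nf
    push_cast
    linear_combination (-(tent N M x : ℂ) * tent N M (x + k)) * this
  have hnorm : ‖weylSum N ψ a‖ ^ 2 = ‖weylSum N ψ a * (starRingEnd ℂ) (weylSum N ψ a)‖ := by
    rw [norm_mul, RCLike.norm_conj, sq]
  rw [hnorm, hexp]
  refine (norm_sum_le _ _).trans ?_
  simp only [norm_mul, hψ, one_mul]
  refine le_trans ?_ (sum_image_le_of_nonneg (f := fun k : ZMod M =>
    ‖∑ x, ((tent N M x * tent N M (x + k) : ℝ) : ℂ) * ψ (a * (2 * k) * x)‖)
    (g := fun k : ℤ => (k : ZMod M)) fun k _ => norm_nonneg _)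
  refine (sum_subset (subset_univ _) fun k _ hk => ?_).ge
  rw [norm_eq_zero]
  refine sum_eq_zero fun x _ => ?_
  by_contra hne
  have h1 : tent N M x ≠ 0 := fun h => by simp [h] at hne
  have h2 : tent N M (x + k) ≠ 0 := fun h => by simp [h] at hne
  obtain ⟨m, hm, rfl⟩ := exists_intCast_of_tent_ne_zero h1
  obtain ⟨n, hn, hk'⟩ := exists_intCast_of_tent_ne_zero h2
  rw [abs_le] at hm hn
  refine hk (mem_image.2 ⟨n - m, mem_Icc.2 (by omega), ?_⟩)
  push_cast
  rw [← hk']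
  ring

end Fejer

/-- The `h ∈ [1, H]` for which `h α` is within `1/(4H)` of an integer. -/
def closeSet (H : ℕ) (α : ℝ) : Finset ℕ :=
  {h ∈ Icc 1 H | |h * α - round (h * α)| ≤ 1 / (4 * H)}

lemma mem_closeSet {H : ℕ} {α : ℝ} {h : ℕ} :
    h ∈ closeSet H α ↔ (1 ≤ h ∧ h ≤ H) ∧ |h * α - round (h * α)| ≤ 1 / (4 * H) := by
  rw [closeSet, mem_filter, mem_Icc]

lemma mem_closeSet_of_abs_sub_le {H : ℕ} {α : ℝ} {h : ℕ} (h1 : 1 ≤ h) (h2 : h ≤ H) (z : ℤ)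
    (hz : |h * α - z| ≤ 1 / (4 * H)) : h ∈ closeSet H α :=
  mem_closeSet.2 ⟨⟨h1, h2⟩, (round_le _ z).trans hz⟩

lemma four_mul_abs_sub_round_le (β : ℝ) :
    4 * |β - round β| ≤ ‖Complex.exp (2 * Real.pi * Complex.I * β) - 1‖ := by
  have h1 : 2 * (Real.pi : ℂ) * Complex.I * β = Complex.I * ((2 * Real.pi * β : ℝ) : ℂ) := by
    push_cast
    ring
  rw [h1, Complex.norm_exp_I_mul_ofReal_sub_one, norm_mul, Real.norm_eq_abs, Real.norm_eq_abs]
  have h2 : |Real.sin (2 * Real.pi * β / 2)| = |Real.sin (Real.pi * (β - round β))| := by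
    rw [show Real.pi * (β - round β) = 2 * Real.pi * β / 2 - round β * Real.pi by ring,
      Real.sin_sub_int_mul_pi, abs_mul, abs_zpow]
    simp
  have hπ := Real.pi_pos
  have h3 := Real.mul_abs_le_abs_sin (x := Real.pi * (β - round β)) (by
    rw [abs_mul, abs_of_pos hπ]
    nlinarith [abs_sub_round β])
  rw [abs_mul, abs_of_pos hπ, ← mul_assoc, div_mul_cancel₀ _ hπ.ne'] at h3
  rw [h2, abs_two]
  linarith

/-- The index of the arc of length `1/(64N)` containing `2kα` modulo one. -/
def arcIndex (N : ℕ) (α : ℝ) (k : ℤ) : ℤ := ⌊64 * N * (2 * k * α - round (2 * k * α))⌋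

lemma card_filter_arcIndex_le {N : ℕ} (hN : 1 ≤ N) (α : ℝ) (i : ℤ) :
    #{k ∈ Icc (-(4 * N : ℤ)) (4 * N) |
      arcIndex N α k = i} ≤ #(closeSet (16 * N) α) + 1 := by
  set s := {k ∈ Icc (-(4 * N : ℤ)) (4 * N) |
      arcIndex N α k = i} with hs
  rcases s.eq_empty_or_nonempty with h | hne
  · rw [h]
    simp
  set m := s.min' hne with hm
  have hms : m ∈ s := min'_mem _ _
  have hN' : (0 : ℝ) < N := by exact_mod_cast hN
  rw [← card_erase_add_one hms]
  refine Nat.add_le_add_right (card_le_card_of_injOn (fun k => (2 * (k - m)).toNat) ?_ ?_) 1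
  · intro k hk
    obtain ⟨hkm, hk⟩ := mem_erase.1 hk
    have hlt : m < k := lt_of_le_of_ne (min'_le _ _ hk) (Ne.symm hkm)
    rw [hs, mem_filter, mem_Icc] at hk hms
    have hcast : (((2 * (k - m)).toNat : ℕ) : ℝ) = 2 * (k - m) := by
      have : (((2 * (k - m)).toNat : ℕ) : ℤ) = 2 * (k - m) := Int.toNat_of_nonneg (by omega)
      exact_mod_cast congrArg (Int.cast (R := ℝ)) this
    refine mem_closeSet_of_abs_sub_le (h := (2 * (k - m)).toNat) (by omega) (by omega)
      (round (2 * k * α) - round (2 * m * α)) ?_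
    rw [hcast]
    have h1 := Int.floor_eq_iff.1 hk.2
    have h2 := Int.floor_eq_iff.1 hms.2
    push_cast
    rw [le_div_iff₀ (by positivity), ← abs_of_pos (by positivity : (0 : ℝ) < 4 * (16 * N)),
      ← abs_mul, abs_le]
    constructor <;> nlinarith
  · intro a ha b hb hab
    have ha := (mem_erase.1 ha)
    have hb := (mem_erase.1 hb)
    have := min'_le _ _ ha.2
    have := min'_le _ _ hb.2
    simp only at hab
    omega

section WeylSums

variable {M : ℕ} [NeZero M]

lemma norm_stdAddChar (x : ZMod M) : ‖(ZMod.stdAddChar x : ℂ)‖ = 1 :=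
  AddChar.norm_apply _ _

lemma norm_sum_tent_mul_tent_le_arcIndex {N : ℕ} (hM : 2 * N ≤ M) (a : ZMod M) (k : ℤ) :
    ‖∑ x, ((tent N M x * tent N M (x + (k : ZMod M)) : ℝ) : ℂ) *
      ZMod.stdAddChar (a * (2 * (k : ZMod M)) * x)‖ ≤
      12312 * N ^ 3 * (1 / (1 + (arcIndex N (a.val / M) k : ℝ) ^ 2)) := by
  set α : ℝ := a.val / M with hα
  have h1 := norm_sum_tent_mul_tent_le hM ZMod.stdAddChar norm_stdAddChar (k : ZMod M)
    (a * (2 * (k : ZMod M)))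
  have h2 := norm_sub_one_sq_mul_norm_sum_tent_le hM ZMod.stdAddChar norm_stdAddChar (k : ZMod M)
    (a * (2 * (k : ZMod M)))
  set K := ‖∑ x, ((tent N M x * tent N M (x + (k : ZMod M)) : ℝ) : ℂ) *
    ZMod.stdAddChar (a * (2 * (k : ZMod M)) * x)‖ with hK
  have hK0 : 0 ≤ K := norm_nonneg _
  have hchar : (ZMod.stdAddChar (a * (2 * (k : ZMod M))) : ℂ) =
      Complex.exp (2 * Real.pi * Complex.I * ((2 * k * α : ℝ) : ℂ)) := by
    have : a * (2 * (k : ZMod M)) = ((a.val * (2 * k) : ℤ) : ZMod M) := by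
      push_cast
      rw [ZMod.natCast_zmod_val]
    rw [this, ZMod.stdAddChar_coe, hα]
    push_cast
    congr 1
    ring
  rw [hchar] at h2
  have h3 := four_mul_abs_sub_round_le (2 * k * α)
  set t := 2 * k * α - round (2 * k * α) with ht
  have h4 : 16 * t ^ 2 * K ≤ 24 * N := by
    refine le_trans (mul_le_mul_of_nonneg_right ?_ hK0) h2
    calc 16 * t ^ 2 = (4 * |t|) ^ 2 := by rw [mul_pow, sq_abs]; norm_num
      _ ≤ _ := pow_le_pow_left₀ (by positivity) h3 2
  have h5 : (arcIndex N α k : ℝ) ^ 2 ≤ 2 * (64 * N * t) ^ 2 + 2 := by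
    have e1 : (arcIndex N α k : ℝ) ≤ 64 * N * t := Int.floor_le _
    have e2 : 64 * N * t < arcIndex N α k + 1 := Int.lt_floor_add_one _
    nlinarith [sq_nonneg (64 * N * t + (64 * N * t - arcIndex N α k))]
  rw [mul_one_div, le_div_iff₀ (by positivity)]
  have h6 : (N : ℝ) ^ 2 * (16 * t ^ 2 * K) ≤ N ^ 2 * (24 * N) :=
    mul_le_mul_of_nonneg_left h4 (by positivity)
  nlinarith [mul_le_mul_of_nonneg_right h5 hK0]

/-- Weyl's inequality without logarithmic loss. -/
lemma exists_norm_weylSum_sq_le : ∃ C : ℝ, 0 < C ∧ ∀ (N M : ℕ) [NeZero M] (a : ZMod M),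
    1 ≤ N → 2 * N ≤ M →
    ‖weylSum N ZMod.stdAddChar a‖ ^ 2 ≤
      C * N ^ 3 * (#(closeSet (16 * N) (a.val / M)) + 1 : ℕ) := by
  have hsummable : Summable fun i : ℤ => 1 / (1 + (i : ℝ) ^ 2) := by
    refine Summable.of_norm_bounded_eventually (g := fun i : ℤ => 1 / (i : ℝ) ^ 2)
      (Real.summable_one_div_int_pow.2 one_lt_two) ?_
    filter_upwards [(Set.finite_singleton (0 : ℤ)).compl_mem_cofinite] with i hi
    have : (0 : ℝ) < (i : ℝ) ^ 2 := by
      have : (i : ℝ) ≠ 0 := by exact_mod_cast hi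
      positivity
    rw [Real.norm_of_nonneg (by positivity)]
    exact one_div_le_one_div_of_le this (by linarith)
  set B := ∑' i : ℤ, 1 / (1 + (i : ℝ) ^ 2)
  have hB : 0 < B := hsummable.tsum_pos (fun i => by positivity) 0 (by norm_num)
  refine ⟨12312 * B, by positivity, fun N M _ a hN hM => ?_⟩
  have hN' : (0 : ℝ) < N := by exact_mod_cast hN
  set α : ℝ := a.val / M
  calc ‖weylSum N ZMod.stdAddChar a‖ ^ 2
      ≤ ∑ k ∈ Icc (-(4 * N : ℤ)) (4 * N), 12312 * N ^ 3 * (1 / (1 + (arcIndex N α k : ℝ) ^ 2)) :=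
        (norm_weylSum_sq_le N _ norm_stdAddChar a).trans (sum_le_sum fun k _ =>
          norm_sum_tent_mul_tent_le_arcIndex hM a k)
    _ = ∑ i ∈ (Icc (-(4 * N : ℤ)) (4 * N)).image (arcIndex N α),
        #{k ∈ Icc (-(4 * N : ℤ)) (4 * N) | arcIndex N α k = i} •
          (12312 * N ^ 3 * (1 / (1 + (i : ℝ) ^ 2))) :=
        sum_comp (fun i : ℤ => 12312 * (N : ℝ) ^ 3 * (1 / (1 + (i : ℝ) ^ 2))) (arcIndex N α)
    _ ≤ ∑ i ∈ (Icc (-(4 * N : ℤ)) (4 * N)).image (arcIndex N α),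
        (#(closeSet (16 * N) α) + 1 : ℕ) * (12312 * N ^ 3 * (1 / (1 + (i : ℝ) ^ 2))) := by
        refine sum_le_sum fun i _ => ?_
        rw [nsmul_eq_mul]
        refine mul_le_mul_of_nonneg_right ?_ (by positivity)
        exact_mod_cast card_filter_arcIndex_le hN α i
    _ = 12312 * N ^ 3 * (#(closeSet (16 * N) α) + 1 : ℕ) *
        ∑ i ∈ (Icc (-(4 * N : ℤ)) (4 * N)).image (arcIndex N α), 1 / (1 + (i : ℝ) ^ 2) := by
        rw [mul_sum]
        exact sum_congr rfl fun _ _ => by ring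
    _ ≤ 12312 * N ^ 3 * (#(closeSet (16 * N) α) + 1 : ℕ) * B :=
        mul_le_mul_of_nonneg_left (hsummable.sum_le_tsum _ fun _ _ => by positivity)
          (by positivity)
    _ = _ := by ring

end WeylSums

/-- If many multiples of `α` are close to integers, then `α` has a good rational
approximation with small denominator. -/
lemma exists_denominator {H : ℕ} {α : ℝ} (hne : (closeSet H α).Nonempty) :
    ∃ (q : ℕ) (p : ℤ), 1 ≤ q ∧ #(closeSet H α) * q ≤ H ∧
      #(closeSet H α) * |q * α - p| ≤ 1 / (4 * H) := by
  set q := (closeSet H α).min' hne with hq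
  have hqmem : q ∈ closeSet H α := min'_mem _ _
  obtain ⟨⟨hq1, hqH⟩, hqα⟩ := mem_closeSet.1 hqmem
  set p := round ((q : ℝ) * α)
  have hHpos : (0 : ℝ) < H := by exact_mod_cast hq1.trans hqH
  have hcop : IsCoprime (q : ℤ) p := by
    rw [Int.isCoprime_iff_gcd_eq_one]
    have hg0 : 0 < Int.gcd (q : ℤ) p := Int.gcd_pos_of_ne_zero_left _ (by omega)
    set g := Int.gcd (q : ℤ) p with hg
    obtain ⟨q', hq'⟩ : g ∣ q := by
      have := Int.gcd_dvd_left (q : ℤ) p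
      exact_mod_cast this
    obtain ⟨p', hp'⟩ : (g : ℤ) ∣ p := Int.gcd_dvd_right _ _
    have hq'1 : 1 ≤ q' := Nat.pos_of_ne_zero fun h => by
      rw [h] at hq'
      omega
    have hle : q' ≤ q := hq' ▸ Nat.le_mul_of_pos_left _ hg0
    have hg1 : (1 : ℝ) ≤ g := by exact_mod_cast hg0
    have hmem : q' ∈ closeSet H α := by
      refine mem_closeSet_of_abs_sub_le hq'1 (hle.trans hqH) p' (le_trans ?_ hqα)
      have e : (q : ℝ) * α - p = g * (q' * α - p') := by
        rw [hp', hq']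
        push_cast
        ring
      rw [e, abs_mul, Nat.abs_cast]
      exact le_mul_of_one_le_left (abs_nonneg _) hg1
    have hmin : q ≤ q' := min'_le _ _ hmem
    have : g * q' ≤ 1 * q' := by omega
    have := Nat.le_of_mul_le_mul_right this hq'1
    omega
  have hdet {h : ℕ} (hh : h ∈ closeSet H α) : (h : ℤ) * p = q * round ((h : ℝ) * α) := by
    obtain ⟨⟨-, hhH⟩, hhα⟩ := mem_closeSet.1 hh
    set r := round ((h : ℝ) * α)
    have hhH' : (h : ℝ) ≤ H := by exact_mod_cast hhH
    have hqH' : (q : ℝ) ≤ H := by exact_mod_cast hqH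
    have hlt : |((h * p - q * r : ℤ) : ℝ)| < 1 := by
      have e : ((h * p - q * r : ℤ) : ℝ) = q * (h * α - r) - h * (q * α - p) := by
        push_cast
        ring
      rw [e]
      calc _ ≤ (q : ℝ) * |h * α - r| + h * |q * α - p| := by
            refine (abs_sub _ _).trans (le_of_eq ?_)
            rw [abs_mul, abs_mul, Nat.abs_cast, Nat.abs_cast]
        _ ≤ H * (1 / (4 * H)) + H * (1 / (4 * H)) := by gcongr
        _ < 1 := by
            field_simp
            norm_num
    have h0 : (h * p - q * r : ℤ) = 0 := Int.abs_lt_one_iff.1 (by exact_mod_cast hlt)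
    omega
  have hdvd {h : ℕ} (hh : h ∈ closeSet H α) : q ∣ h := by
    have : (q : ℤ) ∣ h * p := ⟨_, hdet hh⟩
    exact_mod_cast hcop.dvd_of_dvd_mul_right this
  set m := (closeSet H α).max' hne
  have hm : m ∈ closeSet H α := max'_mem _ _
  obtain ⟨j, hj⟩ := hdvd hm
  have hcard : #(closeSet H α) ≤ j := by
    calc #(closeSet H α) ≤ #(Icc 1 j) := by
          refine card_le_card_of_injOn (· / q) (fun h hh => ?_) fun a ha b hb hab => ?_
          · obtain ⟨i, rfl⟩ := hdvd hh
            have hle : q * i ≤ q * j := hj ▸ le_max' _ _ hh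
            have h1 := (mem_closeSet.1 hh).1.1
            simp only [Nat.mul_div_cancel_left i hq1, mem_coe, mem_Icc]
            exact ⟨Nat.pos_of_ne_zero fun h => by simp [h] at h1, Nat.le_of_mul_le_mul_left hle hq1⟩
          · exact (Nat.div_left_inj (hdvd ha) (hdvd hb)).1 hab
      _ = j := by simp
  obtain ⟨⟨-, hmH⟩, hmα⟩ := mem_closeSet.1 hm
  have hround : round ((m : ℝ) * α) = j * p := by
    have := hdet hm
    rw [hj] at this
    push_cast at this
    have hq0 : (q : ℤ) ≠ 0 := by omega
    refine (mul_left_cancel₀ hq0 ?_).symm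
    rw [← mul_assoc, this, hj]
    push_cast
    rfl
  refine ⟨q, p, hq1, (Nat.mul_le_mul_right q hcard).trans (by rw [mul_comm, ← hj]; exact hmH), ?_⟩
  refine le_trans ?_ hmα
  rw [hround, hj]
  push_cast
  rw [show (q : ℝ) * j * α - j * p = j * (q * α - p) by ring, abs_mul, Nat.abs_cast]
  exact mul_le_mul_of_nonneg_right (by exact_mod_cast hcard) (abs_nonneg _)

lemma card_le_of_abs_sub_le (s : Finset ℕ) (c r : ℝ) (hr : 0 ≤ r)
    (h : ∀ v ∈ s, |(v : ℝ) - c| ≤ r) : (#s : ℝ) ≤ 2 * r + 1 := by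
  have hsub : #s ≤ #(Icc ⌈c - r⌉ ⌊c + r⌋) := by
    refine card_le_card_of_injOn (fun v : ℕ => (v : ℤ)) (fun v hv => ?_)
      (Nat.cast_injective.injOn)
    have := abs_le.1 (h v hv)
    rw [mem_coe, mem_Icc, Int.ceil_le, Int.le_floor]
    push_cast
    constructor <;> linarith
  refine (Nat.cast_le.2 hsub).trans ?_
  rw [Int.card_Icc]
  have h1 := Int.floor_le (c + r)
  have h2 := Int.le_ceil (c - r)
  rcases le_total 0 (⌊c + r⌋ + 1 - ⌈c - r⌉) with h0 | h0
  · have : (((⌊c + r⌋ + 1 - ⌈c - r⌉).toNat : ℕ) : ℝ) = ⌊c + r⌋ + 1 - ⌈c - r⌉ := by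
      have := Int.toNat_of_nonneg h0
      exact_mod_cast congrArg (Int.cast (R := ℝ)) this
    rw [this]
    linarith
  · rw [Int.toNat_of_nonpos h0]
    push_cast
    linarith

/-- The measure of the set of `a/M` having at least `K` small multiples is `O(K⁻²)`. -/
lemma card_le_card_closeSet_le {H M K : ℕ} [NeZero M] (hH : 1 ≤ H) (hHM : H ^ 2 ≤ M)
    (hK : 1 ≤ K) :
    (#{a : ZMod M | K ≤ #(closeSet H (a.val / M))} : ℝ) ≤ 3 * M / K ^ 2 := by
  classical
  have hH' : (0 : ℝ) < H := by exact_mod_cast hH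
  have hK' : (0 : ℝ) < K := by exact_mod_cast hK
  have hM' : (0 : ℝ) < M := by exact_mod_cast NeZero.pos M
  set Q := H / K with hQ
  have hQ' : (Q : ℝ) ≤ H / K := Nat.cast_div_le
  set arc : ℕ → ℕ → Finset (ZMod M) := fun q p =>
    {a | K * |q * ((a.val : ℝ) / M) - p| ≤ 1 / (4 * H)} with harc
  have hsub : ({a : ZMod M | K ≤ #(closeSet H (a.val / M))} : Finset (ZMod M)) ⊆
      (Icc 1 Q).biUnion fun q => (range (q + 1)).biUnion fun p => arc q p := by
    intro a ha
    have hKa := (mem_filter.1 ha).2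
    obtain ⟨q, p, hq1, hqH, hqα⟩ := exists_denominator
      (card_pos.1 (show 0 < #(closeSet H ((a.val : ℝ) / M)) by omega))
    set α := (a.val : ℝ) / M with hα
    have hKα : K * |q * α - p| ≤ 1 / (4 * H) := by
      refine le_trans ?_ hqα
      gcongr
    have hα0 : 0 ≤ α := by positivity
    have hα1 : α ≤ 1 := by
      rw [hα, div_le_one hM']
      exact_mod_cast (ZMod.val_lt a).le
    have hsmall : |q * α - p| < 1 := by
      have h1 : (1 : ℝ) ≤ K := by exact_mod_cast hK
      have h2 : 1 / (4 * (H : ℝ)) < 1 := by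
        rw [div_lt_one (by positivity)]
        have : (1 : ℝ) ≤ H := by exact_mod_cast hH
        linarith
      nlinarith [abs_nonneg (q * α - p)]
    obtain ⟨hs1, hs2⟩ := abs_lt.1 hsmall
    have hq0 : (0 : ℝ) ≤ q := by positivity
    have hp0 : 0 ≤ p := by
      have : ((-1 : ℤ) : ℝ) < p := by
        push_cast
        nlinarith
      have := Int.cast_lt.1 this
      omega
    have hpq : p < q + 1 := by
      have : (p : ℝ) < ((q + 1 : ℤ) : ℝ) := by
        push_cast
        nlinarith
      exact Int.cast_lt.1 this
    lift p to ℕ using hp0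
    refine mem_biUnion.2 ⟨q, mem_Icc.2 ⟨hq1, ?_⟩, mem_biUnion.2 ⟨p, mem_range.2 (by omega), ?_⟩⟩
    · rw [hQ, Nat.le_div_iff_mul_le hK]
      calc q * K ≤ q * #(closeSet H α) := Nat.mul_le_mul_left _ hKa
        _ ≤ H := by rwa [mul_comm]
    · rw [harc, mem_filter]
      exact ⟨mem_univ _, by exact_mod_cast hKα⟩
  have hcard (q p : ℕ) (hq : 1 ≤ q) : (#(arc q p) : ℝ) ≤ M / (2 * H * K * q) + 1 := by
    have hq' : (0 : ℝ) < q := by exact_mod_cast hq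
    rw [← card_image_of_injective (arc q p) (ZMod.val_injective M)]
    refine (card_le_of_abs_sub_le _ (p * M / q) (M / (4 * H * K * q)) (by positivity)
      fun v hv => ?_).trans (le_of_eq ?_)
    · obtain ⟨a, ha, rfl⟩ := mem_image.1 hv
      have ha := (mem_filter.1 ha).2
      have e : (q : ℝ) * ((a.val : ℝ) / M) - p = q / M * (a.val - p * M / q) := by
        field_simp
      rw [e, abs_mul, abs_of_pos (by positivity)] at ha
      rw [le_div_iff₀ (by positivity)] at ha ⊢
      have : (K * (q / M * |(a.val : ℝ) - p * M / q|) * (4 * H)) =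
        (|(a.val : ℝ) - p * M / q| * (4 * H * K * q)) / M := by ring
      rw [this, div_le_one hM'] at ha
      exact ha
    · field_simp
      ring
  have hHM' : (H : ℝ) ^ 2 ≤ M := by exact_mod_cast hHM
  calc (#{a : ZMod M | K ≤ #(closeSet H (a.val / M))} : ℝ)
      ≤ ∑ q ∈ Icc 1 Q, ∑ p ∈ range (q + 1), (#(arc q p) : ℝ) := by
        refine (Nat.cast_le.2 ((card_le_card hsub).trans (card_biUnion_le.trans
          (sum_le_sum fun q _ => card_biUnion_le)))).trans ?_
        push_cast
        rfl
    _ ≤ ∑ q ∈ Icc 1 Q, (M / (H * K) + 2 * Q : ℝ) := by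
        refine sum_le_sum fun q hq => ?_
        rw [mem_Icc] at hq
        have hq' : (1 : ℝ) ≤ q := by exact_mod_cast hq.1
        have hqQ : (q : ℝ) ≤ Q := by exact_mod_cast hq.2
        refine (sum_le_sum fun p _ => hcard q p hq.1).trans ?_
        rw [sum_const, card_range, nsmul_eq_mul]
        push_cast
        have h0 : 0 ≤ M / (2 * H * K * q : ℝ) := by positivity
        have e : 2 * q * (M / (2 * H * K * q) : ℝ) = M / (H * K) := by field_simp
        nlinarith
    _ = Q * (M / (H * K) + 2 * Q : ℝ) := by
        rw [sum_const, Nat.card_Icc, Nat.add_sub_cancel, nsmul_eq_mul]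
    _ ≤ H / K * (M / (H * K) + 2 * (H / K)) := by gcongr
    _ = (M + 2 * H ^ 2) / K ^ 2 := by field_simp
    _ ≤ _ := by
        gcongr
        linarith

section Moments

variable {M : ℕ}

/-- The dyadic size of the number of small multiples of `a/M`. -/
def arcLevel (H : ℕ) (a : ZMod M) : ℕ := Nat.log 2 (#(closeSet H (a.val / M)) + 1)

lemma arcLevel_le {N : ℕ} (hN : 1 ≤ N) (a : ZMod M) : arcLevel (16 * N) a ≤ Nat.log 2 (32 * N) := by
  refine Nat.log_mono_right ?_
  have : #(closeSet (16 * N) (a.val / M)) ≤ 16 * N := by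
    refine (card_filter_le _ _).trans ?_
    simp
  omega

lemma addChar_sum {ι : Type*} (ψ : AddChar (ZMod M) ℂ) (s : Finset ι) (u : ι → ZMod M) :
    ψ (∑ i ∈ s, u i) = ∏ i ∈ s, ψ (u i) := by
  classical
  induction s using Finset.induction_on with
  | empty => simp
  | insert i s hi ih => rw [sum_insert hi, prod_insert hi, AddChar.map_add_eq_mul, ih]

variable [NeZero M]

lemma sum_stdAddChar_mul (b : ZMod M) :
    ∑ x : ZMod M, (ZMod.stdAddChar (x * b) : ℂ) = if b = 0 then (M : ℂ) else 0 := by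
  have := AddChar.sum_mulShift b (ZMod.isPrimitive_stdAddChar M)
  rw [this, ZMod.card]
  push_cast
  rfl

/-- Parseval's identity on `ℤ/M`. -/
lemma sum_norm_sq_fourier (s : Finset (ZMod M)) (F : ZMod M → ℂ) :
    ∑ n : ZMod M, ‖∑ a ∈ s, F a * ZMod.stdAddChar (-(a * n))‖ ^ 2 = M * ∑ a ∈ s, ‖F a‖ ^ 2 := by
  have hconj (x : ZMod M) : (starRingEnd ℂ) (ZMod.stdAddChar x : ℂ) = ZMod.stdAddChar (-x) := by
    rw [AddChar.map_neg_eq_inv, Complex.inv_def, Complex.normSq_eq_norm_sq, norm_stdAddChar]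
    simp
  have hsq (z : ℂ) : ((‖z‖ ^ 2 : ℝ) : ℂ) = z * (starRingEnd ℂ) z := by
    rw [Complex.mul_conj, Complex.normSq_eq_norm_sq]
  apply Complex.ofReal_injective
  rw [Complex.ofReal_sum, Complex.ofReal_mul, Complex.ofReal_sum]
  simp only [hsq, map_sum, map_mul, hconj, sum_mul_sum]
  rw [sum_comm, Complex.ofReal_natCast, mul_sum]
  refine sum_congr rfl fun a ha => ?_
  rw [sum_comm]
  have (b : ZMod M) : ∑ n : ZMod M, F a * ZMod.stdAddChar (-(a * n)) *
      ((starRingEnd ℂ) (F b) * ZMod.stdAddChar (- -(b * n))) =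
      if b - a = 0 then F a * (starRingEnd ℂ) (F b) * M else 0 := by
    rw [← mul_ite_zero, ← sum_stdAddChar_mul, mul_sum]
    refine sum_congr rfl fun n _ => ?_
    have : (ZMod.stdAddChar (n * (b - a)) : ℂ) =
        ZMod.stdAddChar (-(a * n)) * ZMod.stdAddChar (- -(b * n)) := by
      rw [← AddChar.map_add_eq_mul]
      ring_nf
    rw [this]
    ring
  simp only [this, sub_eq_zero]
  rw [sum_ite_eq' s a, if_pos ha]
  ring

/-- Fourier inversion for the weighted number of representations modulo `M`. -/
lemma sum_weylSum_pow_mul (N d : ℕ) (n : ZMod M) :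
    ∑ a : ZMod M, weylSum N ZMod.stdAddChar a ^ d * ZMod.stdAddChar (-(a * n)) =
      ((M * ∑ x : Fin d → ZMod M, if ∑ i, x i ^ 2 = n then ∏ i, tent N M (x i) else 0 : ℝ) : ℂ) := by
  have hexp (a : ZMod M) : weylSum N ZMod.stdAddChar a ^ d * ZMod.stdAddChar (-(a * n)) =
      ∑ x : Fin d → ZMod M, ((∏ i, tent N M (x i) : ℝ) : ℂ) *
        ZMod.stdAddChar (a * (∑ i, x i ^ 2 - n)) := by
    rw [weylSum, Fintype.sum_pow, sum_mul]
    refine sum_congr rfl fun x _ => ?_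
    rw [prod_mul_distrib, mul_sub, sub_eq_add_neg, AddChar.map_add_eq_mul, mul_sum,
      addChar_sum, Complex.ofReal_prod, mul_assoc]
  simp only [hexp]
  rw [sum_comm, Complex.ofReal_mul, Complex.ofReal_sum, mul_sum]
  refine sum_congr rfl fun x _ => ?_
  rw [← mul_sum, sum_stdAddChar_mul]
  simp only [sub_eq_zero]
  split_ifs
  · rw [Complex.ofReal_natCast, mul_comm]
  · simp

lemma pow_mul_repCount_le {N d n : ℕ} (hNM : 2 * N < M) (hn : n ≤ N ^ 2) :
    (N : ℝ) ^ d * repCount d n ≤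
      ∑ x : Fin d → ZMod M, if ∑ i, x i ^ 2 = (n : ZMod M) then ∏ i, tent N M (x i) else 0 := by
  classical
  have habs {x : Fin d → ℤ} (hx : x ∈ latticeSphere d n) (i : Fin d) : |x i| ≤ N := by
    rw [mem_latticeSphere] at hx
    have h1 : x i ^ 2 ≤ ∑ i, x i ^ 2 :=
      single_le_sum (f := fun i => x i ^ 2) (fun _ _ => sq_nonneg _) (mem_univ i)
    refine abs_le_of_sq_le_sq ?_ (by positivity)
    rw [hx] at h1
    exact h1.trans (by exact_mod_cast hn)
  have hinj : Set.InjOn (fun (x : Fin d → ℤ) i => (x i : ZMod M)) (latticeSphere d n) := by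
    intro x hx y hy hxy
    ext i
    have h := (ZMod.intCast_eq_intCast_iff_dvd_sub _ _ _).1 (congrFun hxy i)
    have hx' := abs_le.1 (habs hx i)
    have hy' := abs_le.1 (habs hy i)
    have := Int.eq_zero_of_abs_lt_dvd h (by rw [abs_lt]; omega)
    omega
  calc (N : ℝ) ^ d * repCount d n = ∑ _x ∈ latticeSphere d n, (N : ℝ) ^ d := by
        rw [sum_const, nsmul_eq_mul, repCount, mul_comm]
    _ ≤ ∑ x ∈ latticeSphere d n, ∏ i, tent N M (x i : ZMod M) := by
        refine sum_le_sum fun x hx => ?_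
        calc (N : ℝ) ^ d = ∏ _i : Fin d, (N : ℝ) := by simp
          _ ≤ _ := prod_le_prod (fun _ _ => by positivity) fun i _ => le_tent (habs hx i)
    _ = ∑ y ∈ (latticeSphere d n).image fun (x : Fin d → ℤ) i => (x i : ZMod M),
        ∏ i, tent N M (y i) := by rw [sum_image hinj]
    _ ≤ _ := by
        rw [← sum_filter]
        refine sum_le_sum_of_subset_of_nonneg (fun y hy => ?_)
          fun _ _ _ => prod_nonneg fun _ _ => tent_nonneg _ _
        obtain ⟨x, hx, rfl⟩ := mem_image.1 hy
        rw [mem_filter]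
        refine ⟨mem_univ _, ?_⟩
        rw [mem_latticeSphere] at hx
        have := congrArg (Int.cast (R := ZMod M)) hx
        push_cast at this
        exact this

lemma mul_pow_mul_repCount_le_norm {N d n : ℕ} (hNM : 2 * N < M) (hn : n ≤ N ^ 2) :
    (M : ℝ) * (N ^ d * repCount d n) ≤
      ‖∑ a : ZMod M, weylSum N ZMod.stdAddChar a ^ d * ZMod.stdAddChar (-(a * (n : ZMod M)))‖ := by
  rw [sum_weylSum_pow_mul, Complex.norm_real, Real.norm_eq_abs]
  exact (mul_le_mul_of_nonneg_left (pow_mul_repCount_le hNM hn) (by positivity)).trans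
    (le_abs_self _)

lemma card_arcLevel_le {H : ℕ} (hH : 1 ≤ H) (hHM : H ^ 2 ≤ M) (j : ℕ) :
    (#{a : ZMod M | arcLevel H a = j} : ℝ) ≤ 12 * M / 4 ^ j := by
  cases j with
  | zero =>
    have : (#{a : ZMod M | arcLevel H a = 0} : ℝ) ≤ M := by
      exact_mod_cast (card_filter_le _ _).trans (by simp [ZMod.card])
    have hM : (0 : ℝ) ≤ M := by positivity
    rw [pow_zero, div_one]
    linarith
  | succ j =>
    have hsub : ({a : ZMod M | arcLevel H a = j + 1} : Finset (ZMod M)) ⊆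
        ({a : ZMod M | 2 ^ j ≤ #(closeSet H (a.val / M))} : Finset (ZMod M)) := by
      intro a ha
      rw [mem_filter] at ha ⊢
      refine ⟨mem_univ _, ?_⟩
      have h := Nat.pow_log_le_self 2 (Nat.succ_ne_zero #(closeSet H (a.val / M)))
      have h2 : Nat.log 2 (Nat.succ #(closeSet H (a.val / M))) = j + 1 := ha.2
      rw [h2, pow_succ] at h
      have : 1 ≤ 2 ^ j := Nat.one_le_two_pow
      omega
    refine (Nat.cast_le.2 (card_le_card hsub)).trans
      ((card_le_card_closeSet_le hH hHM Nat.one_le_two_pow).trans (le_of_eq ?_))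
    push_cast
    rw [← pow_mul, mul_comm j 2, pow_mul, pow_succ]
    norm_num
    ring

lemma exists_norm_weylSum_le : ∃ B : ℝ, 0 < B ∧ ∀ (N M : ℕ) [NeZero M] (a : ZMod M),
    1 ≤ N → 2 * N ≤ M →
    ‖weylSum N ZMod.stdAddChar a‖ ≤ B * √N ^ 3 * √2 ^ arcLevel (16 * N) a := by
  obtain ⟨C, hC, h⟩ := exists_norm_weylSum_sq_le
  refine ⟨√(2 * C), by positivity, fun N M _ a hN hM => ?_⟩
  refine (sq_le_sq₀ (norm_nonneg _) (by positivity)).1 ((h N M a hN hM).trans ?_)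
  have h1 : #(closeSet (16 * N) (a.val / M)) + 1 ≤ 2 ^ (arcLevel (16 * N) a + 1) :=
    (Nat.lt_pow_succ_log_self one_lt_two _).le
  have h2 : ((#(closeSet (16 * N) (a.val / M)) + 1 : ℕ) : ℝ) ≤
      2 * 2 ^ arcLevel (16 * N) a := by
    rw [← pow_succ']
    exact_mod_cast h1
  rw [mul_pow, mul_pow, Real.sq_sqrt (by positivity), ← pow_mul, mul_comm 3 2, pow_mul,
    Real.sq_sqrt (by positivity), ← pow_mul, mul_comm _ 2, pow_mul, Real.sq_sqrt (by norm_num)]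
  nlinarith [mul_le_mul_of_nonneg_left h2 (by positivity : 0 ≤ C * (N : ℝ) ^ 3)]

end Moments

lemma geom_sum_le_mul_pow {x : ℝ} (hx : 1 < x) (L : ℕ) :
    ∑ j ∈ range (L + 1), x ^ j ≤ x / (x - 1) * x ^ L := by
  rw [geom_sum_eq hx.ne', div_mul_eq_mul_div, ← pow_succ']
  have : 0 < x - 1 := sub_pos.2 hx
  gcongr
  linarith

/-- Minkowski's inequality in `ℓ³` for a geometrically growing family. -/
lemma exists_sum_norm_sum_cube_le {x : ℝ} (hx : 1 < x) : ∃ C : ℝ, 0 < C ∧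
    ∀ {ι : Type} [Fintype ι] (L : ℕ) (D : ℝ) (v : ℕ → ι → ℂ), 0 ≤ D →
      (∀ j ≤ L, ∑ n, ‖v j n‖ ^ 3 ≤ D * x ^ j) →
      ∑ n, ‖∑ j ∈ range (L + 1), v j n‖ ^ 3 ≤ D * C * x ^ L := by
  set y : ℝ := x ^ (1 / 3 : ℝ) with hy
  have hx0 : 0 ≤ x := by linarith
  have cube_root {t : ℝ} (ht : 0 ≤ t) : (t ^ (1 / 3 : ℝ)) ^ 3 = t := by
    rw [← Real.rpow_natCast, ← Real.rpow_mul ht]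
    norm_num
  have hy3 : y ^ 3 = x := cube_root hx0
  have hy1 : 1 < y := Real.one_lt_rpow hx (by norm_num)
  have hy0 : 0 < y - 1 := by linarith
  refine ⟨(y / (y - 1)) ^ 3, by positivity, fun {ι} _ L D v hD h => ?_⟩
  have : Fact ((1 : ℝ≥0∞) ≤ 3) := ⟨by norm_num⟩
  have hnorm (w : ι → ℂ) : ‖(WithLp.toLp 3 w : PiLp 3 fun _ : ι => ℂ)‖ =
      (∑ n, ‖w n‖ ^ 3) ^ (1 / 3 : ℝ) := by
    rw [PiLp.norm_eq_sum (by norm_num)]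
    norm_num
  have hcube (w : ι → ℂ) : ∑ n, ‖w n‖ ^ 3 =
      ‖(WithLp.toLp 3 w : PiLp 3 fun _ : ι => ℂ)‖ ^ 3 := by
    rw [hnorm, cube_root (sum_nonneg fun _ _ => by positivity)]
  have hsum : (WithLp.toLp 3 (fun n => ∑ j ∈ range (L + 1), v j n) : PiLp 3 fun _ : ι => ℂ) =
      ∑ j ∈ range (L + 1), WithLp.toLp 3 (v j) := by
    ext n
    simp
  rw [hcube, hsum]
  calc _ ≤ (D ^ (1 / 3 : ℝ) * (y / (y - 1) * y ^ L)) ^ 3 := by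
        refine pow_le_pow_left₀ (norm_nonneg _) ((norm_sum_le _ _).trans ?_) 3
        refine le_trans ?_ (mul_le_mul_of_nonneg_left (geom_sum_le_mul_pow hy1 L) (by positivity))
        rw [mul_sum]
        refine sum_le_sum fun j hj => ?_
        refine (pow_le_pow_iff_left₀ (norm_nonneg _) (by positivity) three_ne_zero).1 ?_
        rw [← hcube, mul_pow, cube_root hD, ← pow_mul, mul_comm j, pow_mul, hy3]
        exact h j (Nat.lt_succ_iff.1 (mem_range.1 hj))
    _ = _ := by
        rw [mul_pow, mul_pow, cube_root hD, ← pow_mul y, mul_comm L, pow_mul, hy3, mul_assoc]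

lemma sqrt_two_pow_div_pow_log_le (k i : ℕ) {N : ℕ} (hN : 1 ≤ N) :
    (√2 ^ k / 4 ^ i) ^ Nat.log 2 (32 * N) ≤ √(32 * N) ^ k / (16 * N) ^ (2 * i) := by
  set L := Nat.log 2 (32 * N) with hL
  have h1 : (2 : ℝ) ^ L ≤ 32 * N := by
    exact_mod_cast Nat.pow_log_le_self 2 (by omega)
  have h2 : 16 * (N : ℝ) ≤ 2 ^ L := by
    have : 32 * N < 2 ^ (L + 1) := Nat.lt_pow_succ_log_self one_lt_two _
    have : 16 * N ≤ 2 ^ L := by omega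
    exact_mod_cast this
  have hN' : (0 : ℝ) < N := by exact_mod_cast hN
  have h3 : √2 ^ L ≤ √(32 * N) := by
    refine Real.le_sqrt_of_sq_le ?_
    rwa [← pow_mul, mul_comm L, pow_mul, Real.sq_sqrt (by norm_num)]
  rw [div_pow, ← pow_mul, ← pow_mul, mul_comm k, pow_mul]
  have h4 : (4 : ℝ) ^ (i * L) = (2 ^ L) ^ (2 * i) := by
    rw [show (4 : ℝ) = 2 ^ 2 by norm_num, ← pow_mul, ← pow_mul]
    ring_nf
  rw [h4]
  gcongr

section Arcs

variable {M : ℕ} [NeZero M]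

/-- The contribution of the frequencies of level `j` to the `d`-th power of the Weyl sums. -/
def arcSum (N d j : ℕ) (n : ZMod M) : ℂ :=
  ∑ a : ZMod M with arcLevel (16 * N) a = j,
    weylSum N ZMod.stdAddChar a ^ d * ZMod.stdAddChar (-(a * n))

lemma sum_arcSum {N : ℕ} (hN : 1 ≤ N) (d : ℕ) (n : ZMod M) :
    ∑ j ∈ range (Nat.log 2 (32 * N) + 1), arcSum N d j n =
      ∑ a : ZMod M, weylSum N ZMod.stdAddChar a ^ d * ZMod.stdAddChar (-(a * n)) :=
  sum_fiberwise_of_maps_to (fun a _ => mem_range.2 (Nat.lt_succ_of_le (arcLevel_le hN a))) _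

end Arcs

lemma exists_arcSum_bounds : ∃ B : ℝ, 0 < B ∧ ∀ (d N M j : ℕ) [NeZero M],
    1 ≤ N → (16 * N) ^ 2 ≤ M →
    (∀ n : ZMod M, ‖arcSum N d j n‖ ≤ 12 * M * (B * √N ^ 3) ^ d * (√2 ^ d / 4) ^ j) ∧
    ∑ n : ZMod M, ‖arcSum N d j n‖ ^ 2 ≤
      12 * M ^ 2 * (B * √N ^ 3) ^ (2 * d) * (√2 ^ (2 * d) / 4) ^ j := by
  obtain ⟨B, hB, h⟩ := exists_norm_weylSum_le
  refine ⟨B, hB, fun d N M j _ hN hM => ?_⟩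
  have hNM : 2 * N ≤ M := by nlinarith
  have hcard := card_arcLevel_le (M := M) (by omega : 1 ≤ 16 * N) hM j
  have hpow (k : ℕ) {a : ZMod M}
      (ha : a ∈ ({a : ZMod M | arcLevel (16 * N) a = j} : Finset (ZMod M))) :
      ‖weylSum N ZMod.stdAddChar a‖ ^ k ≤ (B * √N ^ 3) ^ k * (√2 ^ k) ^ j := by
    rw [mem_filter] at ha
    have := h N M a hN hNM
    rw [ha.2] at this
    calc _ ≤ _ := pow_le_pow_left₀ (norm_nonneg _) this k
      _ = _ := by ring
  have hsum (k : ℕ) : ∑ a : ZMod M with arcLevel (16 * N) a = j,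
      ‖weylSum N ZMod.stdAddChar a‖ ^ k ≤
        12 * M * (B * √N ^ 3) ^ k * (√2 ^ k / 4) ^ j := by
    calc _ ≤ _ := sum_le_card_nsmul _ _ _ fun a ha => hpow k ha
      _ ≤ 12 * M / 4 ^ j * ((B * √N ^ 3) ^ k * (√2 ^ k) ^ j) := by
        rw [nsmul_eq_mul]
        gcongr
      _ = _ := by
        rw [div_pow]
        ring
  constructor
  · intro n
    refine (norm_sum_le _ _).trans (le_trans (le_of_eq ?_) (hsum d))
    refine sum_congr rfl fun a _ => ?_
    rw [norm_mul, norm_stdAddChar, mul_one, norm_pow]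
  · simp only [arcSum]
    rw [sum_norm_sq_fourier]
    simp only [norm_pow, ← pow_mul, mul_comm d 2]
    calc _ ≤ _ := mul_le_mul_of_nonneg_left (hsum (2 * d)) (by positivity : (0 : ℝ) ≤ M)
      _ = _ := by ring

/-- The number of representations of `n` as a sum of `d ≥ 5` squares is `O(n^{d/2-1})`. -/
lemma exists_repCount_mul_sq_le {d : ℕ} (hd : 5 ≤ d) : ∃ C : ℝ, 0 < C ∧
    ∀ N n : ℕ, 1 ≤ N → n ≤ N ^ 2 → (repCount d n : ℝ) * N ^ 2 ≤ C * N ^ d := by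
  obtain ⟨B, hB, h⟩ := exists_arcSum_bounds
  set x : ℝ := √2 ^ d / 4 with hx
  have hx1 : 1 < x := by
    rw [hx, lt_div_iff₀ (by norm_num)]
    have h4 : √2 ^ 4 = 4 := by
      rw [show 4 = 2 * 2 by norm_num, pow_mul, Real.sq_sqrt (by norm_num)]
      norm_num
    rw [one_mul, ← h4]
    exact pow_lt_pow_right₀ (Real.lt_sqrt_of_sq_lt (by norm_num)) hd
  have hx0 : 0 < x - 1 := by linarith
  refine ⟨12 * B ^ d * (x / (x - 1)) * √32 ^ d / 16 ^ 2, by positivity, fun N n hN hn => ?_⟩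
  have hN' : (0 : ℝ) < N := by exact_mod_cast hN
  set M := (16 * N) ^ 2 with hM
  have : NeZero M := ⟨by positivity⟩
  have hM0 : (0 : ℝ) < M := by exact_mod_cast Nat.pos_of_neZero M
  have key : (M : ℝ) * (N ^ d * repCount d n) ≤
      12 * M * (B * √N ^ 3) ^ d * (x / (x - 1) * (√(32 * N) ^ d / (16 * N) ^ (2 * 1))) := by
    refine (mul_pow_mul_repCount_le_norm (by rw [hM]; nlinarith) hn).trans ?_
    rw [← sum_arcSum hN]
    refine (norm_sum_le _ _).trans ((sum_le_sum fun j _ => (h d N M j hN le_rfl).1 _).trans ?_)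
    rw [← mul_sum]
    have h1 := geom_sum_le_mul_pow hx1 (Nat.log 2 (32 * N))
    have h2 := sqrt_two_pow_div_pow_log_le d 1 hN
    rw [pow_one, ← hx] at h2
    gcongr
    exact h1.trans (by gcongr)
  have hs : (√N : ℝ) ^ (3 * d) * √N ^ d = N ^ d * N ^ d := by
    rw [← pow_add, ← pow_add, show 3 * d + d = 2 * (d + d) by ring, pow_mul,
      Real.sq_sqrt hN'.le]
  have key2 : (N : ℝ) ^ d * M * (repCount d n * N ^ 2) ≤
      (N : ℝ) ^ d * M * (12 * B ^ d * (x / (x - 1)) * √32 ^ d / 16 ^ 2 * N ^ d) := by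
    calc _ = (M : ℝ) * (N ^ d * repCount d n) * N ^ 2 := by ring
      _ ≤ _ := mul_le_mul_of_nonneg_right key (by positivity)
      _ = 12 * M * B ^ d * (x / (x - 1)) * √32 ^ d / 16 ^ 2 * (√N ^ (3 * d) * √N ^ d) := by
        rw [Real.sqrt_mul (by norm_num), mul_pow, mul_pow, mul_pow, ← pow_mul]
        field_simp
        ring
      _ = _ := by
        rw [hs]
        ring
  exact le_of_mul_le_mul_left key2 (by positivity)

/-- The third moment of the number of representations as a sum of `d ≥ 3` squares. -/
lemma exists_sum_repCount_cube_le {d : ℕ} (hd : 3 ≤ d) : ∃ C : ℝ, 0 < C ∧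
    ∀ N : ℕ, 1 ≤ N →
      (∑ n ∈ range (N ^ 2 + 1), (repCount d n : ℝ) ^ 3) * N ^ 4 ≤ C * N ^ (3 * d) := by
  obtain ⟨B, hB, h⟩ := exists_arcSum_bounds
  set x : ℝ := √2 ^ (3 * d) / 4 ^ 2 with hx
  have hx1 : 1 < x := by
    rw [hx, lt_div_iff₀ (by norm_num)]
    have h4 : √2 ^ 8 = 4 ^ 2 := by
      rw [show 8 = 2 * 4 by norm_num, pow_mul, Real.sq_sqrt (by norm_num)]
      norm_num
    rw [one_mul, ← h4]
    exact pow_lt_pow_right₀ (Real.lt_sqrt_of_sq_lt (by norm_num)) (by omega)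
  obtain ⟨C, hC, hmink⟩ := exists_sum_norm_sum_cube_le hx1
  refine ⟨144 * B ^ (3 * d) * C * √32 ^ (3 * d) / 16 ^ 4, by positivity, fun N hN => ?_⟩
  have hN' : (0 : ℝ) < N := by exact_mod_cast hN
  set M := (16 * N) ^ 2 with hM
  have : NeZero M := ⟨by positivity⟩
  have hM0 : (0 : ℝ) < M := by exact_mod_cast Nat.pos_of_neZero M
  have hNM : N ^ 2 < M := by rw [hM]; nlinarith
  have hinj : Set.InjOn (fun n : ℕ => (n : ZMod M)) (range (N ^ 2 + 1)) := by
    intro a ha b hb hab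
    rw [mem_coe, mem_range] at ha hb
    have := (ZMod.natCast_eq_natCast_iff' a b M).1 hab
    rwa [Nat.mod_eq_of_lt (by omega), Nat.mod_eq_of_lt (by omega)] at this
  have key : (∑ n ∈ range (N ^ 2 + 1), (repCount d n : ℝ) ^ 3) * (M * N ^ d) ^ 3 ≤
      144 * M ^ 3 * (B * √N ^ 3) ^ (3 * d) * C *
        (√(32 * N) ^ (3 * d) / (16 * N) ^ (2 * 2)) := by
    calc _ ≤ ∑ n ∈ range (N ^ 2 + 1),
          ‖∑ j ∈ range (Nat.log 2 (32 * N) + 1), arcSum N d j (n : ZMod M)‖ ^ 3 := by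
          rw [sum_mul]
          refine sum_le_sum fun n hn => ?_
          rw [sum_arcSum hN, ← mul_pow]
          refine pow_le_pow_left₀ (by positivity) ?_ 3
          refine le_trans (le_of_eq (by ring))
            (mul_pow_mul_repCount_le_norm (by rw [hM]; nlinarith)
              (Nat.lt_succ_iff.1 (mem_range.1 hn)))
      _ ≤ ∑ n : ZMod M, ‖∑ j ∈ range (Nat.log 2 (32 * N) + 1), arcSum N d j n‖ ^ 3 := by
          rw [← sum_image (f := fun n : ZMod M =>
            ‖∑ j ∈ range (Nat.log 2 (32 * N) + 1), arcSum N d j n‖ ^ 3) hinj]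
          exact sum_le_sum_of_subset_of_nonneg (subset_univ _) fun _ _ _ => by positivity
      _ ≤ 144 * M ^ 3 * (B * √N ^ 3) ^ (3 * d) * C * x ^ Nat.log 2 (32 * N) := by
          refine hmink _ _ (fun j n => arcSum N d j n) (by positivity) fun j _ => ?_
          obtain ⟨h1, h2⟩ := h d N M j hN le_rfl
          calc _ ≤ ∑ n : ZMod M, 12 * M * (B * √N ^ 3) ^ d * (√2 ^ d / 4) ^ j *
                ‖arcSum N d j n‖ ^ 2 := by
                refine sum_le_sum fun n _ => ?_
                rw [pow_succ']
                exact mul_le_mul_of_nonneg_right (h1 n) (by positivity)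
            _ ≤ 12 * M * (B * √N ^ 3) ^ d * (√2 ^ d / 4) ^ j *
                (12 * M ^ 2 * (B * √N ^ 3) ^ (2 * d) * (√2 ^ (2 * d) / 4) ^ j) := by
                rw [← mul_sum]
                gcongr
            _ = 144 * M ^ 3 * ((B * √N ^ 3) ^ d * (B * √N ^ 3) ^ (2 * d)) *
                ((√2 ^ d / 4) * (√2 ^ (2 * d) / 4)) ^ j := by
                rw [mul_pow (√2 ^ d / 4)]
                ring
            _ = _ := by
                rw [← pow_add, hx, div_mul_div_comm, ← pow_add, show d + 2 * d = 3 * d by ring,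
                  ← sq]
      _ ≤ _ := by
          have := sqrt_two_pow_div_pow_log_le (3 * d) 2 hN
          rw [← hx] at this
          gcongr
  have hs : (√N : ℝ) ^ (3 * (3 * d)) * √N ^ (3 * d) = (N ^ d) ^ 3 * N ^ (3 * d) := by
    rw [← pow_add, ← pow_mul, ← pow_add, show 3 * (3 * d) + 3 * d = 2 * (d * 3 + 3 * d) by ring,
      pow_mul, Real.sq_sqrt hN'.le]
  have key2 : (M * N ^ d : ℝ) ^ 3 *
      ((∑ n ∈ range (N ^ 2 + 1), (repCount d n : ℝ) ^ 3) * N ^ 4) ≤ (M * N ^ d : ℝ) ^ 3 *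
      (144 * B ^ (3 * d) * C * √32 ^ (3 * d) / 16 ^ 4 * N ^ (3 * d)) := by
    calc _ = (∑ n ∈ range (N ^ 2 + 1), (repCount d n : ℝ) ^ 3) * (M * N ^ d) ^ 3 * N ^ 4 := by ring
      _ ≤ _ := mul_le_mul_of_nonneg_right key (by positivity)
      _ = 144 * M ^ 3 * B ^ (3 * d) * C * √32 ^ (3 * d) / 16 ^ 4 *
          (√N ^ (3 * (3 * d)) * √N ^ (3 * d)) := by
        rw [Real.sqrt_mul (by norm_num), mul_pow, mul_pow, mul_pow, ← pow_mul (√N)]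
        field_simp
        ring
      _ = _ := by
        rw [hs]
        ring
  exact le_of_mul_le_mul_left key2 (by positivity)

lemma ncount_eq_repCount (d n : ℕ) : Ncount d n = repCount (d + d) n := by
  rw [repCount, ← Nat.card_eq_finsetCard, Ncount]
  refine Nat.card_congr ((Fin.appendEquiv d d).subtypeEquiv fun uv => ?_)
  rw [mem_latticeSphere, Fin.sum_univ_add]
  simp only [Fin.appendEquiv, Equiv.coe_fn_mk, Fin.append_left, Fin.append_right]
  rfl

/-- The number of lattice points on the sphere of radius `√n` in `ℝ^{2d}` is at least a multiple
of `n^{d-1}`. -/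
lemma exists_pow_le_mul_ncount {d : ℕ} (hd : 3 ≤ d) : ∃ K : ℝ≥0, ∀ n : ℕ,
    ((n.sqrt + 1 : ℕ) : ℝ≥0∞) ^ (2 * d - 2) ≤ K * Ncount d n := by
  obtain ⟨c, hc, h⟩ := exists_le_repCount (2 * d - 5)
  have key (n : ℕ) : ((n.sqrt + 1 : ℕ) : ℝ) ^ (2 * d - 2) ≤
      (1 + 2 ^ (2 * d - 2) / c) * Ncount d n := by
    rw [ncount_eq_repCount]
    rcases Nat.eq_zero_or_pos n with rfl | hn
    · have : 0 < (2 : ℝ) ^ (2 * d - 2) / c := by positivity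
      have h1 : repCount (d + d) ((0 : ℕ) : ℤ) = 1 := repCount_at_zero _
      rw [h1]
      simpa using this.le
    · have hs : 1 ≤ n.sqrt := Nat.sqrt_pos.2 hn
      have h1 := h n.sqrt n hs (by exact_mod_cast Nat.sqrt_le' n)
      rw [show 2 * d - 5 + 3 = 2 * d - 2 by omega, show 2 * d - 5 + 5 = d + d by omega] at h1
      calc ((n.sqrt + 1 : ℕ) : ℝ) ^ (2 * d - 2) ≤ (2 * n.sqrt : ℝ) ^ (2 * d - 2) := by
            gcongr
            exact_mod_cast (by omega : n.sqrt + 1 ≤ 2 * n.sqrt)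
        _ = 2 ^ (2 * d - 2) / c * (c * n.sqrt ^ (2 * d - 2)) := by
            field_simp
            ring
        _ ≤ 2 ^ (2 * d - 2) / c * repCount (d + d) n := by gcongr
        _ ≤ _ := by
            gcongr
            linarith
  refine ⟨Real.toNNReal (1 + 2 ^ (2 * d - 2) / c), fun n => ?_⟩
  have hK : 0 ≤ 1 + 2 ^ (2 * d - 2) / c := by positivity
  have : ((n.sqrt + 1 : ℕ) : ℝ≥0) ^ (2 * d - 2) ≤
      Real.toNNReal (1 + 2 ^ (2 * d - 2) / c) * Ncount d n := by
    rw [← NNReal.coe_le_coe]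
    push_cast [Real.coe_toNNReal _ hK]
    exact_mod_cast key n
  exact_mod_cast this

lemma tsum_sph (d n : ℕ) (g : V d → ℝ≥0∞) (x : V d) {N : ℕ} (hN : n ≤ N ^ 2) :
    ∑' uv : sph d n, g (x - (uv : V d × V d).2) =
      ∑ y ∈ box x N, (repCount d (n - ∑ i, (x i - y i) ^ 2) : ℝ≥0∞) * g y := by
  classical
  have hinner (v : V d) : ∑' u : V d, (sph d n).indicator (fun uv => g (x - uv.2)) (u, v) =
      (repCount d (n - ∑ i, v i ^ 2) : ℝ≥0∞) * g (x - v) := by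
    rw [tsum_eq_sum (s := latticeSphere d (n - ∑ i, v i ^ 2)), repCount, ← nsmul_eq_mul,
      ← sum_const]
    · refine sum_congr rfl fun u hu => ?_
      rw [mem_latticeSphere] at hu
      refine Set.indicator_of_mem ?_ _
      rw [sph, Set.mem_ofPred_eq, hu, sub_add_cancel]
    · intro u hu
      refine Set.indicator_of_notMem (fun h => hu ?_) _
      rw [mem_latticeSphere]
      exact eq_sub_of_add_eq h
  rw [tsum_subtype (sph d n) fun uv => g (x - uv.2), ENNReal.tsum_prod', ENNReal.tsum_comm]
  simp only [hinner]
  rw [← (Equiv.subLeft x).tsum_eq, tsum_eq_sum (s := box x N)]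
  · simp
  · intro y hy
    have : repCount d (n - ∑ i, (x i - y i) ^ 2) = 0 := by
      refine repCount_of_neg ?_
      by_contra! hle
      refine hy (mem_box.2 fun i => ?_)
      have h1 : (x i - y i) ^ 2 ≤ ∑ i, (x i - y i) ^ 2 :=
        single_le_sum (f := fun i => (x i - y i) ^ 2) (fun _ _ => sq_nonneg _) (mem_univ i)
      have h2 : (n : ℤ) ≤ (N : ℤ) ^ 2 := by exact_mod_cast hN
      have := abs_le.1 (abs_le_of_sq_le_sq (by linarith : (x i - y i) ^ 2 ≤ (N : ℤ) ^ 2)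
        (by positivity))
      constructor <;> linarith
    simp [this]

lemma sum_repCount_sq_le (d n : ℕ) (x : V d) (s : Finset (V d)) :
    ∑ y ∈ s, repCount d (n - ∑ i, (x i - y i) ^ 2) ^ 2 ≤
      ∑ m ∈ range (n + 1), repCount d m * repCount d (n - m : ℕ) ^ 2 := by
  classical
  set φ : V d → ℕ := fun y => (∑ i, (x i - y i) ^ 2).toNat with hφ
  have hcast (y : V d) : (φ y : ℤ) = ∑ i, (x i - y i) ^ 2 :=
    Int.toNat_of_nonneg (sum_nonneg fun _ _ => sq_nonneg _)
  have hzero : ∀ y ∈ s, y ∉ s.filter (fun y => φ y ∈ range (n + 1)) →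
      repCount d (n - ∑ i, (x i - y i) ^ 2) ^ 2 = 0 := by
    intro y hy hy'
    rw [mem_filter, not_and, mem_range] at hy'
    rw [repCount_of_neg (by rw [← hcast]; have := hy' hy; omega), zero_pow two_ne_zero]
  rw [← sum_subset (filter_subset _ s) hzero, ← sum_fiberwise_of_maps_to
    (t := range (n + 1)) (g := φ) fun y hy => (mem_filter.1 hy).2]
  refine sum_le_sum fun m hm => ?_
  have hm' : m ≤ n := Nat.lt_succ_iff.1 (mem_range.1 hm)
  refine (sum_le_card_nsmul _ _ (repCount d (n - m : ℕ) ^ 2) fun y hy => ?_).trans ?_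
  · rw [← hcast, (mem_filter.1 hy).2, Nat.cast_sub hm']
  · rw [smul_eq_mul]
    refine Nat.mul_le_mul_right _ (card_le_card_of_injOn (fun y => x - y) (fun y hy => ?_)
      (sub_right_injective.injOn))
    rw [mem_coe, mem_filter] at hy
    rw [mem_coe, mem_latticeSphere, ← hy.2, hcast]
    rfl

/-- The second moment of the multiplicities with which the sphere projects to `ℤ^d`. -/
lemma exists_sum_repCount_sq_le {d : ℕ} (hd : 3 ≤ d) : ∃ C : ℝ, 0 < C ∧
    ∀ (N n : ℕ) (x : V d) (s : Finset (V d)), 1 ≤ N → n ≤ N ^ 2 →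
      (∑ y ∈ s, (repCount d (n - ∑ i, (x i - y i) ^ 2) : ℝ) ^ 2) ≤ C * N ^ (3 * d - 4) := by
  obtain ⟨C, hC, h⟩ := exists_sum_repCount_cube_le hd
  refine ⟨C, hC, fun N n x s hN hn => ?_⟩
  have hN' : (0 : ℝ) < N := by exact_mod_cast hN
  have h1 := h N hN
  rw [show 3 * d = 3 * d - 4 + 4 by omega, pow_add, ← mul_assoc] at h1
  refine le_trans ?_ (le_of_mul_le_mul_right h1 (by positivity))
  calc (∑ y ∈ s, (repCount d (n - ∑ i, (x i - y i) ^ 2) : ℝ) ^ 2) ≤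
        ∑ m ∈ range (n + 1), (repCount d m : ℝ) * (repCount d (n - m : ℕ) : ℝ) ^ 2 := by
        exact_mod_cast sum_repCount_sq_le d n x s
    _ ≤ ∑ m ∈ range (n + 1),
        ((repCount d m : ℝ) ^ 3 + 2 * (repCount d (n - m : ℕ) : ℝ) ^ 3) / 3 := by
        refine sum_le_sum fun m _ => ?_
        have ha : (0 : ℝ) ≤ repCount d m := by positivity
        have hb : (0 : ℝ) ≤ repCount d (n - m : ℕ) := by positivity
        nlinarith [mul_nonneg (add_nonneg ha (mul_nonneg zero_le_two hb))
          (sq_nonneg ((repCount d m : ℝ) - repCount d (n - m : ℕ)))]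
    _ = ∑ m ∈ range (n + 1), (repCount d m : ℝ) ^ 3 := by
        rw [← sum_div, sum_add_distrib, ← mul_sum]
        have := sum_range_reflect (fun m : ℕ => (repCount d m : ℝ) ^ 3) (n + 1)
        simp only [Nat.add_sub_cancel] at this
        rw [this]
        ring
    _ ≤ _ := sum_le_sum_of_subset_of_nonneg (range_mono (by omega)) fun _ _ _ => by positivity

lemma sum_box_le {d N : ℕ} (hN : 1 ≤ N) (g : V d → ℝ≥0∞) (x : V d) :
    ∑ y ∈ box x N, g y ≤ 3 ^ d * (N : ℝ≥0∞) ^ d * boxMax g x := by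
  have h : (∑ y ∈ box x N, g y) / (2 * N + 1 : ℕ) ^ d ≤ boxMax g x :=
    le_iSup (fun N : ℕ => (∑ y ∈ box x N, g y) / (2 * N + 1 : ℕ) ^ d) N
  rw [ENNReal.div_le_iff (by simp) (by finiteness), mul_comm] at h
  refine h.trans ?_
  rw [← mul_pow]
  gcongr
  exact_mod_cast (by omega : 2 * N + 1 ≤ 3 * N)

/-- Averages against the multiplicities are controlled by the Hardy–Littlewood maximal function
of some power `q < p`. -/
lemma exists_sum_repCount_mul_le {d : ℕ} (hd : 3 ≤ d) {p : ℝ}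
    (hp : (d : ℝ) / ((d : ℝ) - 2) < p) : ∃ q : ℝ, 1 ≤ q ∧ q < p ∧ ∃ C : ℝ≥0,
      ∀ (N n : ℕ) (x : V d) (g : V d → ℝ≥0∞), 1 ≤ N → n ≤ N ^ 2 →
        ∑ y ∈ box x N, (repCount d (n - ∑ i, (x i - y i) ^ 2) : ℝ≥0∞) * g y ≤
          C * (N : ℝ≥0∞) ^ (2 * d - 2) * boxMax (fun y => g y ^ q) x ^ (1 / q) := by
  have hd' : (3 : ℝ) ≤ d := by exact_mod_cast hd
  rw [div_lt_iff₀ (by linarith)] at hp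
  rcases le_or_gt 5 d with h5 | h5
  · refine ⟨1, le_rfl, by by_contra! h; nlinarith, ?_⟩
    obtain ⟨C, hC, h⟩ := exists_repCount_mul_sq_le h5
    lift C to ℝ≥0 using hC.le
    refine ⟨C * 3 ^ d, fun N n x g hN hn => ?_⟩
    have hN' : (0 : ℝ) < N := by exact_mod_cast hN
    have hr (y : V d) : (repCount d (n - ∑ i, (x i - y i) ^ 2) : ℝ≥0∞) ≤
        C * (N : ℝ≥0∞) ^ (d - 2) := by
      rcases lt_or_ge (n - ∑ i, (x i - y i) ^ 2 : ℤ) 0 with hneg | hpos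
      · simp [repCount_of_neg hneg]
      · have hsq : 0 ≤ ∑ i, (x i - y i) ^ 2 := sum_nonneg fun _ _ => sq_nonneg _
        lift (n - ∑ i, (x i - y i) ^ 2 : ℤ) to ℕ using hpos with m hm
        have h1 := h N m hN (by omega)
        rw [show d = d - 2 + 2 by omega, pow_add, ← mul_assoc,
          show d - 2 + 2 = d by omega] at h1
        have h2 := le_of_mul_le_mul_right h1 (by positivity)
        have h3 : (repCount d m : ℝ≥0) ≤ C * (N : ℝ≥0) ^ (d - 2) := by
          rw [← NNReal.coe_le_coe]
          exact_mod_cast h2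
        exact_mod_cast h3
    simp only [ENNReal.rpow_one, div_one]
    calc _ ≤ ∑ y ∈ box x N, C * (N : ℝ≥0∞) ^ (d - 2) * g y :=
          sum_le_sum fun y _ => mul_le_mul_left (hr y) _
      _ ≤ C * (N : ℝ≥0∞) ^ (d - 2) * (3 ^ d * (N : ℝ≥0∞) ^ d * boxMax g x) := by
          rw [← mul_sum]
          exact mul_le_mul_right (sum_box_le hN g x) _
      _ = _ := by
          rw [show 2 * d - 2 = d - 2 + d by omega, pow_add]
          push_cast
          ring
  · refine ⟨2, one_le_two, ?_, ?_⟩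
    · have : (d : ℝ) ≤ 4 := by exact_mod_cast Nat.lt_succ_iff.1 h5
      by_contra! h
      nlinarith
    obtain ⟨C, hC, h⟩ := exists_sum_repCount_sq_le hd
    lift C to ℝ≥0 using hC.le
    refine ⟨(C * 3 ^ d) ^ (1 / 2 : ℝ), fun N n x g hN hn => ?_⟩
    have h1 : ∑ y ∈ box x N, (repCount d (n - ∑ i, (x i - y i) ^ 2) : ℝ≥0∞) ^ 2 ≤
        C * (N : ℝ≥0∞) ^ (3 * d - 4) := by
      have : ∑ y ∈ box x N, (repCount d (n - ∑ i, (x i - y i) ^ 2) : ℝ≥0) ^ 2 ≤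
          C * (N : ℝ≥0) ^ (3 * d - 4) := by
        rw [← NNReal.coe_le_coe]
        exact_mod_cast h N n x (box x N) hN hn
      exact_mod_cast this
    refine (ENNReal.inner_le_Lp_mul_Lq _ _ _ Real.HolderConjugate.two_two).trans ?_
    have h2 := sum_box_le hN (fun y => g y ^ (2 : ℝ)) x
    rw [← ENNReal.mul_rpow_of_nonneg _ _ (by norm_num)]
    have hhalf (t : ℝ≥0∞) : (t ^ 2) ^ (1 / 2 : ℝ) = t := by
      rw [← ENNReal.rpow_natCast, ← ENNReal.rpow_mul]
      norm_num
    rw [← hhalf ((N : ℝ≥0∞) ^ (2 * d - 2)), ENNReal.coe_rpow_of_nonneg _ (by norm_num),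
      ← ENNReal.mul_rpow_of_nonneg _ _ (by norm_num),
      ← ENNReal.mul_rpow_of_nonneg _ _ (by norm_num)]
    refine ENNReal.rpow_le_rpow ?_ (by norm_num)
    simp only [ENNReal.rpow_two] at h2 ⊢
    refine (mul_le_mul' h1 h2).trans (le_of_eq ?_)
    rw [← pow_mul, show (2 * d - 2) * 2 = 3 * d - 4 + d by omega, pow_add]
    push_cast
    ring

lemma exists_maxOp_le {d : ℕ} (hd : 3 ≤ d) {p : ℝ}
    (hp : (d : ℝ) / ((d : ℝ) - 2) < p) : ∃ q : ℝ, 1 ≤ q ∧ q < p ∧ ∃ C : ℝ≥0,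
      ∀ (f g : V d → ℂ) (x : V d), maxOp d f g x ≤
        C * linftyNorm d f * boxMax (fun y => (‖g y‖₊ : ℝ≥0∞) ^ q) x ^ (1 / q) := by
  obtain ⟨q, hq1, hqp, C, h⟩ := exists_sum_repCount_mul_le hd hp
  obtain ⟨K, hK⟩ := exists_pow_le_mul_ncount hd
  refine ⟨q, hq1, hqp, C * K, fun f g x => iSup₂_le fun n _ => ?_⟩
  set b := boxMax (fun y => (‖g y‖₊ : ℝ≥0∞) ^ q) x ^ (1 / q)
  have hn : n ≤ (n.sqrt + 1) ^ 2 := (Nat.lt_succ_sqrt' n).le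
  have hsum : ‖∑' uv : sph d n, f (x - (uv : V d × V d).1) * g (x - (uv : V d × V d).2)‖ₑ ≤
      linftyNorm d f * (C * (K * Ncount d n) * b) := by
    calc _ ≤ ∑' uv : sph d n, ‖f (x - (uv : V d × V d).1) * g (x - (uv : V d × V d).2)‖ₑ :=
          enorm_tsum_le_tsum_enorm
      _ ≤ ∑' uv : sph d n, linftyNorm d f * ‖g (x - (uv : V d × V d).2)‖ₑ := by
          refine ENNReal.tsum_le_tsum fun uv => ?_
          rw [enorm_mul]
          exact mul_le_mul_left (le_iSup (fun y : V d => (‖f y‖₊ : ℝ≥0∞)) _) _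
      _ ≤ _ := by
          rw [ENNReal.tsum_mul_left, tsum_sph d n (fun y => ‖g y‖ₑ) x hn]
          refine mul_le_mul_right ((h _ n x _ (Nat.succ_pos _) hn).trans ?_) _
          exact mul_le_mul_left (mul_le_mul_right (hK n) _) _
  calc (‖avg d n f g x‖₊ : ℝ≥0∞) ≤
        (Ncount d n : ℝ≥0∞)⁻¹ * (linftyNorm d f * (C * (K * Ncount d n) * b)) := by
        rw [← enorm_eq_nnnorm, avg, enorm_mul]
        refine mul_le_mul' ?_ hsum
        rcases eq_or_ne (Ncount d n) 0 with h0 | h0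
        · simp [h0]
        · rw [enorm_inv (Nat.cast_ne_zero.2 h0), enorm_eq_nnnorm, Complex.nnnorm_natCast,
            ENNReal.coe_natCast]
    _ = (Ncount d n : ℝ≥0∞)⁻¹ * Ncount d n * (C * K * linftyNorm d f * b) := by ring
    _ ≤ 1 * (C * K * linftyNorm d f * b) := mul_le_mul_left (ENNReal.inv_mul_le_one _) _
    _ = _ := by
        push_cast
        ring

end BilinearSpherical

/-- For `d ≥ 3` and `p > d/(d-2)`, the bilinear discrete spherical maximal
operator is bounded from `l^∞(ℤ^d) × l^p(ℤ^d)` to `l^p(ℤ^d)`. -/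
theorem bilinear_discrete_spherical_linfty_lp_lp
    (d : ℕ) (hd : 3 ≤ d) (p : ℝ) (hp : (d : ℝ) / ((d : ℝ) - 2) < p) :
    ∃ C : ℝ≥0, ∀ f g : V d → ℂ,
      lpNormE d p (maxOp d f g) ≤ C * linftyNorm d f * lpNorm d p g := by
  obtain ⟨q, hq1, hqp, C, h⟩ := BilinearSpherical.exists_maxOp_le hd hp
  have hq0 : 0 < q := by linarith
  have hp0 : 0 < p := by linarith
  obtain ⟨A, hA⟩ := BilinearSpherical.exists_tsum_boxMax_rpow_le d ((one_lt_div hq0).2 hqp)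
  refine ⟨C * A ^ (1 / p), fun f g => ?_⟩
  have hroot (t : ℝ≥0∞) : (t ^ p) ^ (1 / p) = t := by
    rw [← ENNReal.rpow_mul, mul_one_div_cancel hp0.ne', ENNReal.rpow_one]
  have hp' : 0 ≤ 1 / p := by positivity
  have hpow (t : ℝ≥0∞) : (t ^ q) ^ (p / q) = t ^ p := by
    rw [← ENNReal.rpow_mul, mul_div_cancel₀ _ hq0.ne']
  calc lpNormE d p (maxOp d f g)
      ≤ ((C * linftyNorm d f) ^ p * (A * ∑' x : V d, (‖g x‖₊ : ℝ≥0∞) ^ p)) ^ (1 / p) := by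
        refine ENNReal.rpow_le_rpow ?_ hp'
        have h1 := hA fun y => (‖g y‖₊ : ℝ≥0∞) ^ q
        simp only [hpow] at h1
        refine le_trans ?_ (mul_le_mul_right h1 _)
        rw [← ENNReal.tsum_mul_left]
        refine ENNReal.tsum_le_tsum fun x => ?_
        refine (ENNReal.rpow_le_rpow (h f g x) hp0.le).trans (le_of_eq ?_)
        rw [ENNReal.mul_rpow_of_nonneg _ _ hp0.le, ← ENNReal.rpow_mul _ (1 / q), one_div_mul_eq_div]
    _ = _ := by
        rw [ENNReal.mul_rpow_of_nonneg _ _ hp', ENNReal.mul_rpow_of_nonneg _ _ hp', hroot,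
          ENNReal.coe_mul, ENNReal.coe_rpow_of_nonneg _ hp', lpNorm]
        ring
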